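/- arXiv:1107.2314 — 3 statements merged into one kernel-verified Lean document; each statement's English description precedes it below -/
import Mathlib

section
/- There exist universal constants B₁, B₂ > 0 such that for every compact convex set Γ ⊆ ℝ² with nonempty interior and every integer n ≥ 3, if P(n,Γ) denotes the probability that n independent points, each uniformly distributed on Γ, are in convex position, then B₁ < n² · P(n,Γ)^{1/n} < B₂. -/
open MeasureTheory Set Filter

noncomputable section

abbrev Pt : Type := ℝ × ℝ

/-- A finite point set is in general position: no three distinct points are collinear. -/
def GenPos (X : Finset Pt) : Prop :=
  ∀ a ∈ X, ∀ b ∈ X, ∀ c ∈ X, a ≠ b → a ≠ c → b ≠ c → ¬ Collinear ℝ ({a, b, c} : Set Pt)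

/-- `e` is an edge of `X`: an unordered pair of distinct points of `X`. -/
def IsEdgeOf (X : Finset Pt) (e : Sym2 Pt) : Prop :=
  ¬ e.IsDiag ∧ ∀ p ∈ e, p ∈ X

/-- The closed segment joining the two points of an unordered pair. -/
def edgeSeg (e : Sym2 Pt) : Set Pt :=
  Sym2.lift ⟨fun u v => segment ℝ u v, fun u v => segment_symm ℝ u v⟩ e

/-- `M` is a non-crossing perfect matching of `X`: a partition of `X` into unordered pairs
whose closed segments are pairwise disjoint. -/
def IsNCMatching (X : Finset Pt) (M : Finset (Sym2 Pt)) : Prop :=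
  (∀ e ∈ M, IsEdgeOf X e) ∧
  (∀ p ∈ X, ∃! e, e ∈ M ∧ p ∈ e) ∧
  (M : Set (Sym2 Pt)).Pairwise fun e f => Disjoint (edgeSeg e) (edgeSeg f)

/-- The matching `M` avoids the edge set `S`. -/
def Avoids (M S : Finset (Sym2 Pt)) : Prop := ∀ e ∈ M, e ∉ S

/-- The uniform probability distribution on `Γ`: normalized Lebesgue measure restricted to `Γ`. -/
def unifOn (Γ : Set Pt) : Measure Pt := (volume Γ)⁻¹ • volume.restrict Γ

/-- The probability that `n` i.i.d. uniform points in `Γ` are in convex position. -/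
def probConvexPos (Γ : Set Pt) (n : ℕ) : ℝ :=
  (Measure.pi (fun _ : Fin n => unifOn Γ)
    {x : Fin n → Pt | ∀ i, x i ∈ Set.extremePoints ℝ (convexHull ℝ (Set.range x))}).toReal

/-- If the preimages of a measurable set under finitely many measure-preserving maps are
disjoint subsets of `B`, then its measure is at most that of `B` divided by their number. -/
theorem card_mul_measure_le_of_disjoint_preimages {X ι : Type*} [MeasurableSpace X] [Fintype ι]
    {μ : Measure X} {φ : ι → X → X} (hφ : ∀ i, MeasurePreserving (φ i) μ μ) {S B : Set X}
    (hS : MeasurableSet S) (hdisj : Pairwise fun i j => Disjoint (φ i ⁻¹' S) (φ j ⁻¹' S))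
    (hB : ∀ i, φ i ⁻¹' S ⊆ B) : (Fintype.card ι : ENNReal) * μ S ≤ μ B := by
  calc (Fintype.card ι : ENNReal) * μ S = ∑ i, μ (φ i ⁻¹' S) := by
        simp [(hφ _).measure_preimage hS.nullMeasurableSet]
    _ = μ (⋃ i, φ i ⁻¹' S) := by
        rw [measure_iUnion hdisj fun i => (hφ i).measurable hS, tsum_fintype]
    _ ≤ μ B := measure_mono (iUnion_subset hB)

/-- The map sending a sequence to its first term followed by its consecutive differences. -/
def increments (m : ℕ) : (Fin (m + 1) → ℝ) →ₗ[ℝ] (Fin (m + 1) → ℝ) where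
  toFun x := Fin.cons (x 0) fun j : Fin m => x j.succ - x j.castSucc
  map_add' x y := by
    ext i
    refine Fin.cases ?_ (fun j => ?_) i
    · simp
    · simp; ring
  map_smul' c x := by
    ext i
    refine Fin.cases ?_ (fun j => ?_) i
    · simp
    · simp; ring

@[simp] theorem increments_zero {m : ℕ} (x : Fin (m + 1) → ℝ) : increments m x 0 = x 0 := rfl

@[simp] theorem increments_succ {m : ℕ} (x : Fin (m + 1) → ℝ) (j : Fin m) :
    increments m x j.succ = x j.succ - x j.castSucc := rfl

theorem det_increments (m : ℕ) : LinearMap.det (increments m) = 1 := by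
  rw [← LinearMap.det_toMatrix', Matrix.det_of_isLowerTriangular]
  · refine Finset.prod_eq_one fun i _ => ?_
    rw [LinearMap.toMatrix'_apply]
    refine Fin.cases ?_ (fun j => ?_) i
    · simp
    · rw [increments_succ]
      simp [Fin.castSucc_lt_succ.ne]
  · intro i j hij
    have hij : i < j := hij
    rw [LinearMap.toMatrix'_apply]
    revert hij
    refine Fin.cases (fun h => ?_) (fun i h => ?_) i
    · simp [h.ne]
    · rw [increments_succ]
      simp [h.ne, (Fin.castSucc_lt_succ.trans h).ne]

theorem measurePreserving_increments (m : ℕ) :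
    MeasurePreserving (increments m) (volume : Measure (Fin (m + 1) → ℝ)) volume := by
  refine ⟨(increments m).continuous_of_finiteDimensional.measurable, ?_⟩
  rw [Measure.map_linearMap_addHaar_eq_smul_addHaar _ (by simp [det_increments])]
  simp [det_increments]

theorem sum_increments {m : ℕ} (x : Fin (m + 1) → ℝ) :
    ∑ i, increments m x i = x (Fin.last m) := by
  have h₁ := Fin.sum_univ_succ x
  have h₂ := Fin.sum_univ_castSucc x
  simp only [Fin.sum_univ_succ (increments m x), increments_zero, increments_succ,
    Finset.sum_sub_distrib]
  linarith

/-- Increment vectors of strictly increasing sequences in `[0, 4]`. -/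
def stepSimplex (m : ℕ) : Set (Fin (m + 1) → ℝ) :=
  {u | 0 ≤ u 0 ∧ (∀ i : Fin m, 0 < u i.succ) ∧ ∑ i, u i ≤ 4}

theorem measurableSet_stepSimplex (m : ℕ) : MeasurableSet (stepSimplex m) := by
  have h : stepSimplex m = {u | 0 ≤ u 0} ∩ (⋂ i : Fin m, {u | 0 < u i.succ}) ∩
      {u | ∑ i, u i ≤ 4} := by
    ext u; simp [stepSimplex, and_assoc]
  rw [h]
  refine ((measurableSet_le (by fun_prop) (by fun_prop)).inter
    (MeasurableSet.iInter fun i => measurableSet_lt (by fun_prop) (by fun_prop))).inter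
    (measurableSet_le (by fun_prop) (by fun_prop))

theorem increments_mem_stepSimplex {m : ℕ} {x : Fin (m + 1) → ℝ} :
    increments m x ∈ stepSimplex m ↔ 0 ≤ x 0 ∧ StrictMono x ∧ x (Fin.last m) ≤ 4 := by
  simp [stepSimplex, sum_increments, Fin.strictMono_iff_lt_succ]

theorem perm_eq_of_strictMono_comp {m : ℕ} {f : Fin m → ℝ} {σ τ : Equiv.Perm (Fin m)}
    (hσ : StrictMono (f ∘ σ)) (hτ : StrictMono (f ∘ τ)) : σ = τ := by
  have hf : Function.Injective f := by
    have := hσ.injective.comp σ.symm.injective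
    simpa [Function.comp_assoc] using this
  ext i
  exact congrArg Fin.val (hf (congrFun (Tuple.unique_monotone hσ.monotone hτ.monotone) i))

theorem measurePreserving_comp_perm {ι : Type*} [Fintype ι] {α : Type*} [MeasureSpace α]
    [SigmaFinite (volume : Measure α)] (σ : Equiv.Perm ι) :
    MeasurePreserving (fun x : ι → α => x ∘ σ) volume volume := by
  have := volume_measurePreserving_piCongrLeft (fun _ : ι => α) σ.symm
  convert this using 1
  ext x i
  simp [MeasurableEquiv.piCongrLeft, Equiv.piCongrLeft, Equiv.piCongrLeft']

theorem factorial_mul_volume_stepSimplex_le (m : ℕ) :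
    ((m + 1).factorial : ENNReal) * volume (stepSimplex m) ≤ 4 ^ (m + 1) := by
  rw [← (measurePreserving_increments m).measure_preimage
    (measurableSet_stepSimplex m).nullMeasurableSet]
  have h := card_mul_measure_le_of_disjoint_preimages (μ := volume)
    (φ := fun (σ : Equiv.Perm (Fin (m + 1))) (x : Fin (m + 1) → ℝ) => x ∘ σ)
    (fun σ => measurePreserving_comp_perm σ) (S := increments m ⁻¹' stepSimplex m)
    (B := Set.pi univ fun _ => Icc (0 : ℝ) 4)
    ((measurePreserving_increments m).measurable (measurableSet_stepSimplex m))
    (fun σ τ hne => Set.disjoint_left.2 fun x hσ hτ => hne <|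
      perm_eq_of_strictMono_comp (increments_mem_stepSimplex.1 hσ).2.1
        (increments_mem_stepSimplex.1 hτ).2.1)
    (fun σ x hx i _ => by
      obtain ⟨h0, hmono, h4⟩ := increments_mem_stepSimplex.1 hx
      have h₁ := hmono.monotone (Fin.zero_le (σ.symm i))
      have h₂ := hmono.monotone (Fin.le_last (σ.symm i))
      simp only [Function.comp_apply, Equiv.apply_symm_apply] at h0 h₁ h₂ h4
      exact ⟨h0.trans h₁, h₂.trans h4⟩)
  rw [volume_pi_pi] at h
  simpa [Fintype.card_perm] using h

/-- Pairs of increment vectors whose slopes are strictly monotone. -/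
def convexSteps (m : ℕ) : Set ((Fin (m + 1) → ℝ) × (Fin (m + 1) → ℝ)) :=
  {w | w.1 ∈ stepSimplex m ∧ w.2 ∈ stepSimplex m ∧
    StrictMono fun i : Fin m => w.1 i.succ / w.2 i.succ}

theorem measurableSet_convexSteps (m : ℕ) : MeasurableSet (convexSteps m) := by
  have h : MeasurableSet (⋂ (i : Fin m) (j : Fin m) (_ : i < j),
      {w : (Fin (m + 1) → ℝ) × (Fin (m + 1) → ℝ) |
        w.1 i.succ / w.2 i.succ < w.1 j.succ / w.2 j.succ}) :=
    MeasurableSet.iInter fun i => MeasurableSet.iInter fun j => MeasurableSet.iInter fun _ =>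
      measurableSet_lt (by fun_prop) (by fun_prop)
  convert (measurable_fst (measurableSet_stepSimplex m)).inter
    ((measurable_snd (measurableSet_stepSimplex m)).inter h) using 1
  ext w
  simp [convexSteps, StrictMono]

/-- The extension of a permutation of `Fin m` to `Fin (m + 1)` that fixes `0`. -/
def extendPerm {m : ℕ} (σ : Equiv.Perm (Fin m)) : Equiv.Perm (Fin (m + 1)) :=
  Equiv.Perm.decomposeFin.symm (0, σ)

theorem extendPerm_zero {m : ℕ} (σ : Equiv.Perm (Fin m)) : extendPerm σ 0 = 0 := by
  simp [extendPerm]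

theorem extendPerm_succ {m : ℕ} (σ : Equiv.Perm (Fin m)) (i : Fin m) :
    extendPerm σ i.succ = (σ i).succ := by
  simp [extendPerm]

theorem comp_extendPerm_mem_stepSimplex {m : ℕ} {σ : Equiv.Perm (Fin m)} {u : Fin (m + 1) → ℝ}
    (h : u ∘ extendPerm σ ∈ stepSimplex m) : u ∈ stepSimplex m := by
  obtain ⟨h0, hpos, hsum⟩ := h
  refine ⟨by simpa [extendPerm_zero] using h0, fun i => ?_, ?_⟩
  · simpa [extendPerm_succ] using hpos (σ.symm i)
  · simpa [Function.comp_apply, Equiv.sum_comp (extendPerm σ) u] using hsum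

theorem factorial_mul_volume_convexSteps_le (m : ℕ) :
    (m.factorial : ENNReal) * volume (convexSteps m) ≤ volume (stepSimplex m) ^ 2 := by
  have h := card_mul_measure_le_of_disjoint_preimages (μ := volume)
    (φ := fun (σ : Equiv.Perm (Fin m)) =>
      Prod.map (fun u : Fin (m + 1) → ℝ => u ∘ extendPerm σ)
        (fun u : Fin (m + 1) → ℝ => u ∘ extendPerm σ))
    (fun σ => (measurePreserving_comp_perm _).prod (measurePreserving_comp_perm _))
    (S := convexSteps m) (B := stepSimplex m ×ˢ stepSimplex m) (measurableSet_convexSteps m)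
    (fun σ τ hne => Set.disjoint_left.2 fun w hσ hτ => hne <| by
      refine perm_eq_of_strictMono_comp (f := fun i => w.1 i.succ / w.2 i.succ) ?_ ?_
      · simpa [Function.comp_def, extendPerm_succ] using hσ.2.2
      · simpa [Function.comp_def, extendPerm_succ] using hτ.2.2)
    (fun σ w hw => ⟨comp_extendPerm_mem_stepSimplex hw.1, comp_extendPerm_mem_stepSimplex hw.2.1⟩)
  rw [Measure.volume_eq_prod, Measure.prod_prod, ← Measure.volume_eq_prod] at h
  simpa [Fintype.card_perm, sq] using h

/-- Finite families in `[0, 4]²` each of whose members is the strict minimizer of a functional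
`α x - β y` with `0 ≤ α, β`. -/
def lowerRightChains (ι : Type*) : Set (ι → Pt) :=
  {p | (∀ i, p i ∈ Icc (0 : ℝ) 4 ×ˢ Icc (0 : ℝ) 4) ∧
    ∀ i, ∃ α β : ℝ, 0 ≤ α ∧ 0 ≤ β ∧
      ∀ j ≠ i, α * (p i).1 - β * (p i).2 < α * (p j).1 - β * (p j).2}

theorem comp_mem_lowerRightChains {ι κ : Type*} {p : ι → Pt} (hp : p ∈ lowerRightChains ι)
    {f : κ → ι} (hf : Function.Injective f) : p ∘ f ∈ lowerRightChains κ :=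
  ⟨fun i => hp.1 (f i), fun i => by
    obtain ⟨α, β, hα, hβ, h⟩ := hp.2 (f i)
    exact ⟨α, β, hα, hβ, fun j hj => h (f j) (hf.ne hj)⟩⟩

theorem snd_lt_snd_of_mem_lowerRightChains {ι : Type*} {p : ι → Pt}
    (hp : p ∈ lowerRightChains ι) {i j : ι} (hij : i ≠ j) (h : (p i).1 ≤ (p j).1) :
    (p i).2 < (p j).2 := by
  obtain ⟨α, β, hα, hβ, hlt⟩ := hp.2 j
  have := hlt i hij
  by_contra! h'
  nlinarith [mul_le_mul_of_nonneg_left h hα, mul_le_mul_of_nonneg_left h' hβ]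

theorem injective_fst_of_mem_lowerRightChains {ι : Type*} {p : ι → Pt}
    (hp : p ∈ lowerRightChains ι) : Function.Injective fun i => (p i).1 := by
  intro i j hij
  by_contra hne
  exact (snd_lt_snd_of_mem_lowerRightChains hp hne hij.le).asymm
    (snd_lt_snd_of_mem_lowerRightChains hp (Ne.symm hne) hij.ge)

/-- The increments of the two coordinate sequences of a sequence of points. -/
def pointIncrements (m : ℕ) (p : Fin (m + 1) → Pt) :
    (Fin (m + 1) → ℝ) × (Fin (m + 1) → ℝ) :=
  (increments m fun i => (p i).1, increments m fun i => (p i).2)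

theorem measurePreserving_pointIncrements (m : ℕ) :
    MeasurePreserving (pointIncrements m) volume volume :=
  ((measurePreserving_increments m).prod (measurePreserving_increments m)).comp
    (volume_measurePreserving_arrowProdEquivProdArrow ℝ ℝ (Fin (m + 1)))

theorem pointIncrements_mem_convexSteps {m : ℕ} {p : Fin (m + 1) → Pt}
    (hp : p ∈ lowerRightChains (Fin (m + 1))) (hmono : StrictMono fun i => (p i).1) :
    pointIncrements m p ∈ convexSteps m := by
  have hmono' : StrictMono fun i => (p i).2 := fun i j hij =>
    snd_lt_snd_of_mem_lowerRightChains hp hij.ne (hmono hij).le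
  refine ⟨increments_mem_stepSimplex.2 ⟨(hp.1 _).1.1, hmono, (hp.1 _).1.2⟩,
    increments_mem_stepSimplex.2 ⟨(hp.1 _).2.1, hmono', (hp.1 _).2.2⟩, ?_⟩
  cases m with
  | zero => exact Subsingleton.strictMono _
  | succ m =>
    refine Fin.strictMono_iff_lt_succ.2 fun i => ?_
    simp only [pointIncrements, increments_succ]
    obtain ⟨α, β, hα, hβ, h⟩ := hp.2 i.succ.castSucc
    have h₁ := h i.castSucc.castSucc (by simp [Fin.ext_iff])
    have h₂ := h i.succ.succ (by simp [Fin.ext_iff])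
    have hu₁ := hmono (Fin.castSucc_lt_succ (i := i.castSucc))
    have hv₁ := hmono' (Fin.castSucc_lt_succ (i := i.castSucc))
    have hu₂ := hmono (Fin.castSucc_lt_succ (i := i.succ))
    have hv₂ := hmono' (Fin.castSucc_lt_succ (i := i.succ))
    simp only [Fin.succ_castSucc] at *
    rw [div_lt_div_iff₀ (by linarith) (by linarith)]
    generalize (p i.castSucc.castSucc).1 = a₁ at *
    generalize (p i.castSucc.castSucc).2 = b₁ at *
    generalize (p i.succ.castSucc).1 = a₂ at *
    generalize (p i.succ.castSucc).2 = b₂ at *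
    generalize (p i.succ.succ).1 = a₃ at *
    generalize (p i.succ.succ).2 = b₃ at *
    have e₁ : α * (a₂ - a₁) < β * (b₂ - b₁) := by linarith
    have e₂ : β * (b₃ - b₂) < α * (a₃ - a₂) := by linarith
    have e₃ := mul_lt_mul_of_pos_right e₁ (sub_pos.2 hv₂)
    have e₄ := mul_lt_mul_of_pos_right e₂ (sub_pos.2 hv₁)
    refine lt_of_mul_lt_mul_left ?_ hα
    linarith

theorem volume_lowerRightChains_fin_succ_le (m : ℕ) :
    volume (lowerRightChains (Fin (m + 1))) ≤
      ((m + 1).factorial : ENNReal) * volume (convexSteps m) := by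
  have hsub : lowerRightChains (Fin (m + 1)) ⊆ ⋃ σ : Equiv.Perm (Fin (m + 1)),
      (fun p => p ∘ σ) ⁻¹' (pointIncrements m ⁻¹' convexSteps m) := fun p hp => by
    refine mem_iUnion.2 ⟨Tuple.sort fun i => (p i).1, ?_⟩
    refine pointIncrements_mem_convexSteps
      (comp_mem_lowerRightChains hp (Equiv.injective _)) ?_
    exact (Tuple.monotone_sort fun i => (p i).1).strictMono_of_injective
      ((injective_fst_of_mem_lowerRightChains hp).comp (Equiv.injective _))
  have hmeas := (measurePreserving_pointIncrements m).measurable (measurableSet_convexSteps m)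
  refine (measure_mono hsub).trans ((measure_iUnion_le _).trans_eq ?_)
  simp_rw [(measurePreserving_comp_perm _).measure_preimage hmeas.nullMeasurableSet,
    (measurePreserving_pointIncrements m).measure_preimage
      (measurableSet_convexSteps m).nullMeasurableSet]
  simp [tsum_fintype, Fintype.card_perm]

theorem volume_lowerRightChains_fin_le (k : ℕ) :
    (k.factorial : ENNReal) ^ 2 * volume (lowerRightChains (Fin k)) ≤ 32 ^ k := by
  cases k with
  | zero =>
    simpa [volume_pi] using
      measure_mono (μ := (volume : Measure (Fin 0 → Pt))) (subset_univ (lowerRightChains (Fin 0)))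
  | succ m =>
    have h₁ := volume_lowerRightChains_fin_succ_le m
    have h₂ := factorial_mul_volume_convexSteps_le m
    have h₃ := factorial_mul_volume_stepSimplex_le m
    have h₄ : ((m + 1 : ℕ) : ENNReal) ≤ 2 ^ (m + 1) := by
      exact_mod_cast (m + 1).lt_two_pow_self.le
    calc ((m + 1).factorial : ENNReal) ^ 2 * volume (lowerRightChains (Fin (m + 1)))
        ≤ ((m + 1).factorial : ENNReal) ^ 2 *
          (((m + 1).factorial : ENNReal) * volume (convexSteps m)) := by gcongr
      _ = ((m + 1 : ℕ) : ENNReal) * ((m + 1).factorial : ENNReal) ^ 2 *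
          ((m.factorial : ENNReal) * volume (convexSteps m)) := by
        rw [Nat.factorial_succ]; push_cast; ring
      _ ≤ ((m + 1 : ℕ) : ENNReal) * ((m + 1).factorial : ENNReal) ^ 2 *
          volume (stepSimplex m) ^ 2 := by gcongr
      _ = ((m + 1 : ℕ) : ENNReal) *
          (((m + 1).factorial : ENNReal) * volume (stepSimplex m)) ^ 2 := by ring
      _ ≤ 2 ^ (m + 1) * (4 ^ (m + 1)) ^ 2 := by gcongr
      _ = 32 ^ (m + 1) := by
        rw [← pow_mul, mul_comm (m + 1) 2, pow_mul, ← mul_pow]; norm_num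

theorem volume_lowerRightChains_le (ι : Type*) [Fintype ι] :
    ((Fintype.card ι).factorial : ENNReal) ^ 2 * volume (lowerRightChains ι) ≤
      32 ^ Fintype.card ι := by
  refine le_trans ?_ (volume_lowerRightChains_fin_le (Fintype.card ι))
  have e := Fintype.equivFin ι
  have hpres := volume_measurePreserving_piCongrLeft (fun _ : Fin (Fintype.card ι) => Pt) e
  rw [← hpres.measure_preimage_equiv]
  gcongr
  intro p hp
  have : MeasurableEquiv.piCongrLeft (fun _ => Pt) e p = p ∘ e.symm := by
    ext i <;> simp [MeasurableEquiv.piCongrLeft, Equiv.piCongrLeft, Equiv.piCongrLeft']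
  rw [mem_preimage, this]
  exact comp_mem_lowerRightChains hp e.symm.injective

/-- Splitting the coordinates of a product space along the fibres of a map preserves volume. -/
theorem volume_forall_fiber_mem {ι κ : Type*} [Fintype ι] [Fintype κ] [DecidableEq κ]
    {α : Type*} [MeasureSpace α] [SigmaFinite (volume : Measure α)] (c : ι → κ)
    (A : ∀ s, Set ({i // c i = s} → α)) :
    volume {x : ι → α | ∀ s, (fun i : {i // c i = s} => x i) ∈ A s} = ∏ s, volume (A s) := by
  have hcurry : MeasurePreserving
      (MeasurableEquiv.piCurry fun (s : κ) (_ : {i // c i = s}) => α).symm volume volume := by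
    refine ⟨MeasurableEquiv.measurable _, (Measure.pi_eq fun t _ => ?_).symm⟩
    rw [MeasurableEquiv.map_apply]
    have : (MeasurableEquiv.piCurry fun (s : κ) (_ : {i // c i = s}) => α).symm ⁻¹'
        Set.pi univ t = Set.pi univ fun s => Set.pi univ fun i => t ⟨s, i⟩ := by
      ext x
      simp [MeasurableEquiv.coe_piCurry_symm, Sigma.uncurry, Sigma.forall]
    rw [this, volume_pi_pi]
    simp_rw [volume_pi_pi, Fintype.prod_sigma]
  have hpres := (volume_measurePreserving_piCongrLeft (fun _ : ι => α)
    (Equiv.sigmaFiberEquiv c)).comp hcurry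
  rw [← volume_pi_pi, ← MeasurePreserving.measure_preimage_equiv (f := MeasurableEquiv.trans
    (MeasurableEquiv.piCurry fun (s : κ) (_ : {i // c i = s}) => α).symm
    (MeasurableEquiv.piCongrLeft (fun _ : ι => α) (Equiv.sigmaFiberEquiv c))) hpres]
  congr 1
  ext x
  refine forall_congr' fun s => ?_
  simp only [mem_univ, true_imp_iff]
  refine iff_of_eq (congrArg (· ∈ A s) ?_)
  ext ⟨i, rfl⟩
  simp [MeasurableEquiv.piCongrLeft, Equiv.piCongrLeft, Equiv.piCongrLeft',
    MeasurableEquiv.coe_piCurry_symm, Sigma.uncurry, Equiv.sigmaFiberEquiv]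

theorem exists_separating_functional {ι : Type*} [Finite ι] {x : ι → Pt}
    (hx : Function.Injective x) {i : ι}
    (hi : x i ∈ Set.extremePoints ℝ (convexHull ℝ (Set.range x))) :
    ∃ α β : ℝ, ∀ j ≠ i, α * (x i).1 + β * (x i).2 < α * (x j).1 + β * (x j).2 := by
  have hi' := ((convex_convexHull ℝ _).mem_extremePoints_iff_convex_sdiff.1 hi).2
  have hfin : (Set.range x \ {x i}).Finite := (Set.finite_range x).subset sdiff_subset
  have hnot : x i ∉ convexHull ℝ (Set.range x \ {x i}) := fun h =>
    (convexHull_min (sdiff_subset_sdiff_left (subset_convexHull ℝ _)) hi' h).2 rfl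
  obtain ⟨f, u, h₁, h₂⟩ := geometric_hahn_banach_point_closed (convex_convexHull ℝ _)
    (hfin.isCompact_convexHull ℝ).isClosed hnot
  have hf : ∀ p : Pt, f (1, 0) * p.1 + f (0, 1) * p.2 = f p := fun p => by
    have : p = p.1 • ((1, 0) : Pt) + p.2 • ((0, 1) : Pt) := by ext <;> simp
    conv_rhs => rw [this, map_add, map_smul, map_smul, smul_eq_mul, smul_eq_mul]
    ring
  refine ⟨f (1, 0), f (0, 1), fun j hj => ?_⟩
  rw [hf, hf]
  exact h₁.trans (h₂ _ (subset_convexHull ℝ _ ⟨⟨j, rfl⟩, fun h => hj (hx h)⟩))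

/-- The isometry `t ↦ 2 ± t` of the line. -/
def foldSign (b : Bool) (t : ℝ) : ℝ := if b then 2 + t else 2 - t

theorem measurePreserving_foldSign (b : Bool) : MeasurePreserving (foldSign b) volume volume := by
  cases b
  · exact Measure.measurePreserving_sub_left volume 2
  · exact measurePreserving_add_left volume 2

theorem foldSign_mem_Icc {b : Bool} {t : ℝ} (ht : t ∈ Icc (-2 : ℝ) 2) :
    foldSign b t ∈ Icc (0 : ℝ) 4 := by
  obtain ⟨h₁, h₂⟩ := ht
  cases b <;> simp only [foldSign] <;> constructor <;> simp <;> linarith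

theorem exists_foldSign_eq (α : ℝ) : ∃ b, ∀ t, α * t + |α| * 2 = |α| * foldSign b t := by
  rcases le_total 0 α with h | h
  · exact ⟨true, fun t => by simp [foldSign, abs_of_nonneg h]; ring⟩
  · exact ⟨false, fun t => by simp [foldSign, abs_of_nonpos h]; ring⟩

theorem exists_foldSign_eq_neg (β : ℝ) : ∃ b, ∀ t, β * t - |β| * 2 = - (|β| * foldSign b t) := by
  obtain ⟨b, hb⟩ := exists_foldSign_eq (-β)
  refine ⟨b, fun t => ?_⟩
  rw [← abs_neg, ← hb]
  ring

/-- The isometry of the plane acting by `foldSign` on each coordinate. -/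
def foldPoint (b : Bool × Bool) (p : Pt) : Pt := (foldSign b.1 p.1, foldSign b.2 p.2)

theorem measurePreserving_foldPoint (b : Bool × Bool) :
    MeasurePreserving (foldPoint b) volume volume :=
  (measurePreserving_foldSign b.1).prod (measurePreserving_foldSign b.2)

/-- The families that an isometry `foldPoint b` carries into `lowerRightChains`. -/
def foldedChains (ι : Type*) (b : Bool × Bool) : Set (ι → Pt) :=
  (fun p i => foldPoint b (p i)) ⁻¹' lowerRightChains ι

theorem volume_foldedChains_le (ι : Type*) [Fintype ι] (b : Bool × Bool) :
    ((Fintype.card ι).factorial : ENNReal) ^ 2 * volume (foldedChains ι b) ≤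
      32 ^ Fintype.card ι := by
  have h := volume_preserving_pi fun _ : ι => measurePreserving_foldPoint b
  refine le_trans ?_ (volume_lowerRightChains_le ι)
  gcongr _ ^ 2 * ?_
  exact (Measure.le_map_apply h.measurable.aemeasurable _).trans_eq (by rw [h.map_eq])

/-- The square `[-2, 2]²`. -/
def bigSquare : Set Pt := Icc (-2) 2 ×ˢ Icc (-2) 2

theorem exists_forall_fiber_mem_foldedChains {ι : Type*} [Finite ι] {x : ι → Pt}
    (hinj : Function.Injective x) (hbox : ∀ i, x i ∈ bigSquare)
    (hx : ∀ i, x i ∈ Set.extremePoints ℝ (convexHull ℝ (Set.range x))) :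
    ∃ c : ι → Bool × Bool, ∀ s, (fun i : {i // c i = s} => x i) ∈ foldedChains _ s := by
  choose α β h using fun i => exists_separating_functional hinj (hx i)
  choose a ha using fun i => exists_foldSign_eq (α i)
  choose b hb using fun i => exists_foldSign_eq_neg (β i)
  refine ⟨fun i => (a i, b i), fun s => ⟨fun i => ⟨foldSign_mem_Icc (hbox i).1,
    foldSign_mem_Icc (hbox i).2⟩, ?_⟩⟩
  rintro ⟨i, rfl⟩
  refine ⟨|α i|, |β i|, abs_nonneg _, abs_nonneg _, fun j hj => ?_⟩
  have := h i j (fun e => hj (Subtype.ext e))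
  simp only [foldPoint]
  linarith [ha i (x i).1, ha i (x j).1, hb i (x i).2, hb i (x j).2]

theorem volume_not_injective_eq_zero (ι : Type*) [Fintype ι] :
    volume {x : ι → Pt | ¬ Function.Injective x} = 0 := by
  have hsub : {x : ι → Pt | ¬ Function.Injective x} ⊆
      ⋃ (i : ι) (j : ι) (_ : i ≠ j), {x | x i = x j} := fun x hx => by
    simp only [Function.Injective, not_forall, mem_ofPred_eq] at hx
    obtain ⟨i, j, h, hne⟩ := hx
    exact mem_iUnion.2 ⟨i, mem_iUnion.2 ⟨j, mem_iUnion.2 ⟨hne, h⟩⟩⟩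
  refine measure_mono_null hsub (measure_iUnion_null fun i => measure_iUnion_null fun j =>
    measure_iUnion_null fun hij => ?_)
  refine Measure.addHaar_submodule volume
    (LinearMap.ker (LinearMap.proj (R := ℝ) (φ := fun _ : ι => Pt) i - LinearMap.proj j)) ?_ |>
    measure_mono_null fun x hx => by simpa [sub_eq_zero] using hx
  classical
  intro htop
  have : Pi.single i ((1, 0) : Pt) ∈ LinearMap.ker
      (LinearMap.proj (R := ℝ) (φ := fun _ : ι => Pt) i - LinearMap.proj j) := by
    rw [htop]; trivial
  simp [hij.symm] at this

theorem factorial_add_le (a b : ℕ) :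
    (a + b).factorial ≤ 2 ^ (a + b) * (a.factorial * b.factorial) := by
  rw [← Nat.add_choose_mul_factorial_mul_factorial a b, mul_assoc]
  gcongr
  exact Nat.choose_le_two_pow _ _

theorem factorial_sum_le (k : Bool × Bool → ℕ) :
    (∑ b, k b).factorial ≤ 4 ^ (∑ b, k b) * ∏ b, (k b).factorial := by
  simp only [Fintype.sum_prod_type, Fintype.prod_prod_type, Fintype.sum_bool, Fintype.prod_bool]
  refine (factorial_add_le _ _).trans ?_
  calc _ ≤ 2 ^ (k (true, true) + k (true, false) + (k (false, true) + k (false, false))) *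
        ((2 ^ (k (true, true) + k (true, false)) *
          ((k (true, true)).factorial * (k (true, false)).factorial)) *
        (2 ^ (k (false, true) + k (false, false)) *
          ((k (false, true)).factorial * (k (false, false)).factorial))) := by
        gcongr <;> exact factorial_add_le _ _
    _ = _ := by
        rw [show (4 : ℕ) = 2 * 2 from rfl, mul_pow]
        ring

theorem factorial_sq_mul_volume_forall_fiber_le {n : ℕ} (c : Fin n → Bool × Bool) :
    (n.factorial : ENNReal) ^ 2 *
      volume {x : Fin n → Pt | ∀ s, (fun i : {i // c i = s} => x i) ∈ foldedChains _ s} ≤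
      512 ^ n := by
  rw [volume_forall_fiber_mem]
  set k : Bool × Bool → ℕ := fun s => Fintype.card {i // c i = s}
  have hk : ∑ s, k s = n := by
    rw [← Fintype.card_sigma, Fintype.card_congr (Equiv.sigmaFiberEquiv c), Fintype.card_fin]
  have hfac : (n.factorial : ENNReal) ≤ 4 ^ n * ∏ s, ((k s).factorial : ENNReal) := by
    exact_mod_cast hk ▸ factorial_sum_le k
  calc _ ≤ (4 ^ n * ∏ s, ((k s).factorial : ENNReal)) ^ 2 *
        ∏ s, volume (foldedChains {i // c i = s} s) := by gcongr
    _ = (4 ^ n) ^ 2 * ∏ s, (((k s).factorial : ENNReal) ^ 2 *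
        volume (foldedChains {i // c i = s} s)) := by
      rw [Finset.prod_mul_distrib, Finset.prod_pow]; ring
    _ ≤ (4 ^ n) ^ 2 * ∏ s, (32 : ENNReal) ^ k s := by
      gcongr with s
      exact volume_foldedChains_le _ s
    _ = 512 ^ n := by
      rw [Finset.prod_pow_eq_pow_sum, hk, ← pow_mul, mul_comm n 2, pow_mul, ← mul_pow]; norm_num

/-- The families of points in convex position. -/
def convexPosition (n : ℕ) : Set (Fin n → Pt) :=
  {x | ∀ i, x i ∈ Set.extremePoints ℝ (convexHull ℝ (Set.range x))}

theorem factorial_sq_mul_volume_convexPosition_le (n : ℕ) :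
    (n.factorial : ENNReal) ^ 2 *
      volume (convexPosition n ∩ Set.pi univ fun _ => bigSquare) ≤ 2048 ^ n := by
  have hsub : convexPosition n ∩ (Set.pi univ fun _ => bigSquare) ⊆
      {x | ¬ Function.Injective x} ∪ ⋃ c : Fin n → Bool × Bool,
        {x | ∀ s, (fun i : {i // c i = s} => x i) ∈ foldedChains _ s} := fun x hx => by
    by_cases hinj : Function.Injective x
    · obtain ⟨c, hc⟩ := exists_forall_fiber_mem_foldedChains hinj (fun i => hx.2 i trivial) hx.1
      exact Or.inr (mem_iUnion.2 ⟨c, hc⟩)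
    · exact Or.inl hinj
  calc _ ≤ (n.factorial : ENNReal) ^ 2 * ∑ c : Fin n → Bool × Bool,
        volume {x : Fin n → Pt | ∀ s, (fun i : {i // c i = s} => x i) ∈ foldedChains _ s} := by
        gcongr
        refine (measure_mono hsub).trans ((measure_union_le _ _).trans ?_)
        rw [volume_not_injective_eq_zero, zero_add]
        exact measure_iUnion_fintype_le _ _
    _ ≤ ∑ _c : Fin n → Bool × Bool, (512 : ENNReal) ^ n := by
        rw [Finset.mul_sum]
        exact Finset.sum_le_sum fun c _ => factorial_sq_mul_volume_forall_fiber_le c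
    _ = 2048 ^ n := by
        simp only [Finset.sum_const, Finset.card_univ, Fintype.card_fun, Fintype.card_prod,
          Fintype.card_bool, Fintype.card_fin, nsmul_eq_mul, Nat.cast_pow]
        rw [← mul_pow]
        norm_num

theorem mem_extremePoints_of_forall_lt {ι : Type*} {x : ι → Pt} {i : ι} (f : Pt →ₗ[ℝ] ℝ)
    (h : ∀ j ≠ i, f (x i) < f (x j)) :
    x i ∈ Set.extremePoints ℝ (convexHull ℝ (Set.range x)) := by
  have hconv : Convex ℝ {p | p = x i ∨ f (x i) < f p} := by
    rintro p hp q hq a b ha hb hab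
    have he : f (x i) = a * f (x i) + b * f (x i) := by rw [← add_mul, hab, one_mul]
    rcases hp with rfl | hp <;> rcases hq with rfl | hq
    · exact Or.inl (by rw [← add_smul, hab, one_smul])
    · rcases hb.eq_or_lt with rfl | hb
      · exact Or.inl (by simp [show a = 1 by linarith])
      · refine Or.inr ?_
        simp only [map_add, map_smul, smul_eq_mul]
        linarith [mul_lt_mul_of_pos_left hq hb]
    · rcases ha.eq_or_lt with rfl | ha
      · exact Or.inl (by simp [show b = 1 by linarith])
      · refine Or.inr ?_
        simp only [map_add, map_smul, smul_eq_mul]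
        linarith [mul_lt_mul_of_pos_left hp ha]
    · refine Or.inr ?_
      simp only [map_add, map_smul, smul_eq_mul]
      rcases ha.eq_or_lt with rfl | ha
      · simp [show b = 1 by linarith, hq]
      · linarith [mul_lt_mul_of_pos_left hp ha, mul_le_mul_of_nonneg_left hq.le hb]
  have hsub : convexHull ℝ (Set.range x) ⊆ {p | p = x i ∨ f (x i) < f p} := by
    refine convexHull_min ?_ hconv
    rintro _ ⟨j, rfl⟩
    by_cases hj : j = i
    · exact Or.inl (by rw [hj])
    · exact Or.inr (h j hj)
  refine ⟨subset_convexHull ℝ _ ⟨i, rfl⟩, fun p hp q hq hpq => ?_⟩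
  obtain ⟨a, b, ha, hb, hab, he⟩ := hpq
  refine (hsub hp).resolve_right fun hlt => ?_
  have hq' : f (x i) ≤ f q := (hsub hq).elim (fun h => h ▸ le_rfl) le_of_lt
  have := congrArg f he
  simp only [map_add, map_smul, smul_eq_mul] at this
  have hb' : b = 1 - a := by linarith
  subst hb'
  nlinarith

/-- A thin cell above the parabola `y = x² / 2`. -/
def parabolaCell (n : ℕ) (i : Fin n) : Set Pt :=
  regionBetween (fun x => x ^ 2 / 2) (fun x => x ^ 2 / 2 + (n : ℝ)⁻¹ ^ 2 / 8)
    (Icc ((i + 1 / 4) * (n : ℝ)⁻¹) ((i + 3 / 4) * (n : ℝ)⁻¹))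

theorem measurableSet_parabolaCell (n : ℕ) (i : Fin n) : MeasurableSet (parabolaCell n i) :=
  measurableSet_regionBetween (by fun_prop) (by fun_prop) measurableSet_Icc

theorem volume_parabolaCell (n : ℕ) (i : Fin n) :
    volume (parabolaCell n i) = ENNReal.ofReal ((n : ℝ)⁻¹ ^ 3 / 16) := by
  rw [parabolaCell, Measure.volume_eq_prod, volume_regionBetween_eq_lintegral' (by fun_prop)
    (by fun_prop) measurableSet_Icc]
  simp only [Pi.sub_apply, add_sub_cancel_left, lintegral_const, Measure.restrict_apply_univ,
    Real.volume_Icc]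
  rw [← ENNReal.ofReal_mul (by positivity)]
  congr 1
  ring

theorem parabolaCell_subset (n : ℕ) (i : Fin n) :
    parabolaCell n i ⊆ Icc 0 1 ×ˢ Icc 0 1 := by
  rintro p ⟨⟨h₁, h₂⟩, h₃, h₄⟩
  have hn : (1 : ℝ) ≤ n := by exact_mod_cast i.pos
  have hi : (i : ℝ) + 1 ≤ n := by exact_mod_cast i.isLt
  have h0 : 0 < (n : ℝ)⁻¹ := by positivity
  have h1 : (n : ℝ)⁻¹ ≤ 1 := inv_le_one_of_one_le₀ hn
  have hmul : (n : ℝ) * (n : ℝ)⁻¹ = 1 := mul_inv_cancel₀ (by positivity)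
  have hp0 : 0 ≤ p.1 := le_trans (by positivity) h₁
  have hp1 : p.1 ≤ 1 := h₂.trans (by nlinarith)
  exact ⟨⟨hp0, hp1⟩, by nlinarith, by nlinarith⟩

theorem abs_sub_le_of_mem_parabolaCell {n : ℕ} {i : Fin n} {p : Pt} (hp : p ∈ parabolaCell n i) :
    |p.1 - (i + 1 / 2) * (n : ℝ)⁻¹| ≤ (n : ℝ)⁻¹ / 4 := by
  obtain ⟨⟨h₁, h₂⟩, -⟩ := hp
  rw [abs_le]
  constructor <;> linarith

theorem le_abs_sub_of_mem_parabolaCell {n : ℕ} {i j : Fin n} (hij : j ≠ i) {p : Pt}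
    (hp : p ∈ parabolaCell n j) :
    3 / 4 * (n : ℝ)⁻¹ ≤ |p.1 - (i + 1 / 2) * (n : ℝ)⁻¹| := by
  obtain ⟨⟨h₁, h₂⟩, -⟩ := hp
  have h0 : 0 ≤ (n : ℝ)⁻¹ := by positivity
  rw [le_abs]
  rcases lt_or_gt_of_ne hij with h | h
  · have h : (j : ℝ) + 1 ≤ i := by exact_mod_cast h
    exact Or.inr (by nlinarith)
  · have h : (i : ℝ) + 1 ≤ j := by exact_mod_cast h
    exact Or.inl (by nlinarith)

theorem disjoint_parabolaCell {n : ℕ} {i j : Fin n} (hij : i ≠ j) :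
    Disjoint (parabolaCell n i) (parabolaCell n j) := by
  refine Set.disjoint_left.2 fun p hi hj => ?_
  have h0 : 0 < (n : ℝ)⁻¹ := by have := i.pos; positivity
  linarith [abs_sub_le_of_mem_parabolaCell hi, le_abs_sub_of_mem_parabolaCell hij.symm hj]

theorem mem_convexPosition_of_forall_mem_parabolaCell {n : ℕ} {σ : Equiv.Perm (Fin n)}
    {x : Fin n → Pt} (hx : ∀ i, x i ∈ parabolaCell n (σ i)) : x ∈ convexPosition n := by
  intro i
  set t : ℝ := ((σ i : ℕ) + 1 / 2) * (n : ℝ)⁻¹ with ht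
  have h0 : 0 < (n : ℝ)⁻¹ := by have := i.pos; positivity
  refine mem_extremePoints_of_forall_lt (LinearMap.snd ℝ ℝ ℝ - t • LinearMap.fst ℝ ℝ ℝ)
    fun j hj => ?_
  have h₁ := abs_sub_le_of_mem_parabolaCell (hx i)
  have h₂ := le_abs_sub_of_mem_parabolaCell (σ.injective.ne hj) (hx j)
  rw [← ht] at h₁ h₂
  have h₃ : ((x i).1 - t) ^ 2 ≤ ((n : ℝ)⁻¹ / 4) ^ 2 := by
    rw [← sq_abs]; gcongr
  have h₄ : (3 / 4 * (n : ℝ)⁻¹) ^ 2 ≤ ((x j).1 - t) ^ 2 := by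
    rw [← sq_abs ((x j).1 - t)]; gcongr
  have h₅ := (hx i).2.2
  have h₆ := (hx j).2.1
  simp only [LinearMap.sub_apply, LinearMap.smul_apply, LinearMap.snd_apply, LinearMap.fst_apply,
    smul_eq_mul]
  nlinarith

theorem le_volume_convexPosition (n : ℕ) :
    (n.factorial : ENNReal) * ENNReal.ofReal ((n : ℝ)⁻¹ ^ 3 / 16) ^ n ≤
      volume (convexPosition n ∩ Set.pi univ fun _ => Icc (0 : ℝ) 1 ×ˢ Icc (0 : ℝ) 1) := by
  have hdisj : Pairwise fun σ τ : Equiv.Perm (Fin n) =>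
      Disjoint (Set.pi univ fun i => parabolaCell n (σ i))
        (Set.pi univ fun i => parabolaCell n (τ i)) := fun σ τ hne => by
    obtain ⟨i, hi⟩ : ∃ i, σ i ≠ τ i := by
      by_contra! h
      exact hne (Equiv.ext h)
    exact Set.disjoint_left.2 fun x hσ hτ =>
      Set.disjoint_left.1 (disjoint_parabolaCell hi) (hσ i trivial) (hτ i trivial)
  have hsub : (⋃ σ : Equiv.Perm (Fin n), Set.pi univ fun i => parabolaCell n (σ i)) ⊆
      convexPosition n ∩ Set.pi univ fun _ => Icc (0 : ℝ) 1 ×ˢ Icc (0 : ℝ) 1 :=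
    iUnion_subset fun σ x hx => ⟨mem_convexPosition_of_forall_mem_parabolaCell
      fun i => hx i trivial, fun i _ => parabolaCell_subset n _ (hx i trivial)⟩
  refine le_trans (le_of_eq ?_) (measure_mono hsub)
  rw [measure_iUnion hdisj fun σ => MeasurableSet.univ_pi fun i => measurableSet_parabolaCell n _,
    tsum_fintype]
  simp [volume_pi_pi, volume_parabolaCell, Fintype.card_perm]

theorem apply_mem_extremePoints_image_iff (g : Pt ≃ᵃ[ℝ] Pt) (s : Set Pt) (p : Pt) :
    g p ∈ Set.extremePoints ℝ (g '' s) ↔ p ∈ Set.extremePoints ℝ s := by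
  have : ∀ x y, g '' openSegment ℝ x y = openSegment ℝ (g x) (g y) :=
    image_openSegment ℝ g.toAffineMap
  simp only [mem_extremePoints, forall_mem_image, g.injective.mem_set_image,
    g.injective.eq_iff, ← this]

theorem comp_mem_convexPosition_iff {n : ℕ} (g : Pt ≃ᵃ[ℝ] Pt) (x : Fin n → Pt) :
    g ∘ x ∈ convexPosition n ↔ x ∈ convexPosition n := by
  have : convexHull ℝ (Set.range (g ∘ x)) = g '' convexHull ℝ (Set.range x) := by
    rw [Set.range_comp]
    exact (AffineMap.image_convexHull g.toAffineMap _).symm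
  refine forall_congr' fun i => ?_
  rw [this]
  exact apply_mem_extremePoints_image_iff g _ _

theorem exists_map_affineEquiv_volume_eq_smul (g : Pt ≃ᵃ[ℝ] Pt) :
    ∃ c : ENNReal, c ≠ 0 ∧ c ≠ ⊤ ∧ (volume : Measure Pt).map g = c • volume := by
  have hdet : LinearMap.det (g.linear : Pt →ₗ[ℝ] Pt) ≠ 0 := g.linear.isUnit_det'.ne_zero
  refine ⟨ENNReal.ofReal |(LinearMap.det (g.linear : Pt →ₗ[ℝ] Pt))⁻¹|, ?_,
    ENNReal.ofReal_ne_top, ?_⟩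
  · simpa using hdet
  · have hg : (g : Pt → Pt) = (fun p => g 0 + p) ∘ (g.linear : Pt →ₗ[ℝ] Pt) := by
      ext1 p
      have := g.map_vadd 0 p
      simpa [add_comm] using this
    rw [hg, ← Measure.map_map (by fun_prop)
      (LinearMap.continuous_of_finiteDimensional _).measurable,
      Measure.map_linearMap_addHaar_eq_smul_addHaar _ hdet, Measure.map_smul,
      map_add_left_eq_self]

theorem isProbabilityMeasure_unifOn {Γ : Set Pt} (h0 : volume Γ ≠ 0) (h1 : volume Γ ≠ ⊤) :
    IsProbabilityMeasure (unifOn Γ) :=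
  ⟨by simp [unifOn, ENNReal.inv_mul_cancel h0 h1]⟩

theorem pi_unifOn {Γ : Set Pt} (h0 : volume Γ ≠ 0) (h1 : volume Γ ≠ ⊤) (n : ℕ) :
    Measure.pi (fun _ : Fin n => unifOn Γ) =
      (volume Γ)⁻¹ ^ n • volume.restrict (Set.pi univ fun _ : Fin n => Γ) := by
  have := isProbabilityMeasure_unifOn h0 h1
  refine Measure.pi_eq fun s hs => ?_
  rw [volume_pi, Measure.restrict_pi_pi]
  simp [unifOn, Finset.prod_mul_distrib, Measure.pi_pi]

/-- The measurable equivalence underlying an affine equivalence of the plane. -/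
def affineMeasurableEquiv (g : Pt ≃ᵃ[ℝ] Pt) : Pt ≃ᵐ Pt :=
  (AffineEquiv.toContinuousAffineEquiv g).toHomeomorph.toMeasurableEquiv

theorem coe_affineMeasurableEquiv (g : Pt ≃ᵃ[ℝ] Pt) : ⇑(affineMeasurableEquiv g) = g := rfl

theorem measurePreserving_unifOn (g : Pt ≃ᵃ[ℝ] Pt) (Γ : Set Pt) :
    MeasurePreserving (affineMeasurableEquiv g) (unifOn (g ⁻¹' Γ)) (unifOn Γ) := by
  obtain ⟨c, hc0, hc1, hc⟩ := exists_map_affineEquiv_volume_eq_smul g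
  rw [← coe_affineMeasurableEquiv] at hc ⊢
  refine ⟨MeasurableEquiv.measurable _, ?_⟩
  have hv : volume (affineMeasurableEquiv g ⁻¹' Γ) = c * volume Γ := by
    rw [← MeasurableEquiv.map_apply, hc]; rfl
  rw [unifOn, unifOn, Measure.map_smul, ← MeasurableEquiv.restrict_map, hc, hv,
    Measure.restrict_smul, smul_smul, ENNReal.mul_inv (Or.inl hc0) (Or.inl hc1), mul_right_comm,
    ENNReal.inv_mul_cancel hc0 hc1, one_mul]

theorem probConvexPos_preimage (g : Pt ≃ᵃ[ℝ] Pt) {Γ : Set Pt} (h0 : volume Γ ≠ 0)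
    (h1 : volume Γ ≠ ⊤) (n : ℕ) : probConvexPos (g ⁻¹' Γ) n = probConvexPos Γ n := by
  have := isProbabilityMeasure_unifOn h0 h1
  have hp := measurePreserving_unifOn g Γ
  have : IsProbabilityMeasure (unifOn (g ⁻¹' Γ)) := by
    refine ⟨?_⟩
    have := hp.measure_preimage_equiv univ
    simpa using this
  have hpi : MeasurePreserving
      (MeasurableEquiv.piCongrRight fun _ : Fin n => affineMeasurableEquiv g)
      (Measure.pi fun _ => unifOn (g ⁻¹' Γ)) (Measure.pi fun _ => unifOn Γ) :=
    measurePreserving_pi _ _ fun _ => hp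
  have := hpi.measure_preimage_equiv (convexPosition n)
  rw [probConvexPos, probConvexPos]
  change (_ : ENNReal).toReal = (Measure.pi (fun _ : Fin n => unifOn Γ) (convexPosition n)).toReal
  rw [← this]
  congr 2
  ext x
  exact (comp_mem_convexPosition_iff g x).symm

/-- Twice the signed area of a triangle. -/
def triangleDet (a b c : Pt) : ℝ := (b.1 - a.1) * (c.2 - a.2) - (b.2 - a.2) * (c.1 - a.1)

theorem exists_max_triangle {Γ : Set Pt} (hc : IsCompact Γ) (hi : (interior Γ).Nonempty) :
    ∃ a ∈ Γ, ∃ b ∈ Γ, ∃ c ∈ Γ, triangleDet a b c ≠ 0 ∧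
      ∀ a' ∈ Γ, ∀ b' ∈ Γ, ∀ c' ∈ Γ, |triangleDet a' b' c'| ≤ |triangleDet a b c| := by
  obtain ⟨p, hp⟩ := hi
  obtain ⟨ε, hε, hball⟩ := Metric.isOpen_iff.1 isOpen_interior p hp
  have hmem : ∀ u v : ℝ, |u| < ε → |v| < ε → (p.1 + u, p.2 + v) ∈ Γ := fun u v hu hv =>
    interior_subset (hball (by simp [Prod.dist_eq, hu, hv]))
  have hcont : ContinuousOn (fun t : Pt × Pt × Pt => |triangleDet t.1 t.2.1 t.2.2|)
      (Γ ×ˢ Γ ×ˢ Γ) := by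
    unfold triangleDet
    fun_prop
  have hΓ := interior_subset hp
  obtain ⟨⟨a, b, c⟩, ⟨ha, hb, hc⟩, hmax⟩ :=
    (hc.prod (hc.prod hc)).exists_isMaxOn ⟨(p, p, p), hΓ, hΓ, hΓ⟩ hcont
  refine ⟨a, ha, b, hb, c, hc, fun h => ?_, fun a' ha' b' hb' c' hc' =>
    hmax (show (a', b', c') ∈ Γ ×ˢ Γ ×ˢ Γ from ⟨ha', hb', hc'⟩)⟩
  have h2 : |ε / 2| < ε := by rw [abs_of_pos (by positivity)]; linarith
  have h0 : |(0 : ℝ)| < ε := by simpa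
  have := hmax (show ((p.1 + 0, p.2 + 0), (p.1 + ε / 2, p.2 + 0), (p.1 + 0, p.2 + ε / 2)) ∈
    Γ ×ˢ Γ ×ˢ Γ from ⟨hmem _ _ h0 h0, hmem _ _ h2 h0, hmem _ _ h0 h2⟩)
  simp only [mem_ofPred_eq, h, abs_zero] at this
  have h3 := abs_nonpos_iff.1 this
  simp only [triangleDet] at h3
  nlinarith [mul_pos hε hε]

theorem exists_affineEquiv_preimage_between {Γ : Set Pt} (hc : IsCompact Γ) (hconv : Convex ℝ Γ)
    (hi : (interior Γ).Nonempty) :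
    ∃ g : Pt ≃ᵃ[ℝ] Pt, Icc (0 : ℝ) 1 ×ˢ Icc (0 : ℝ) 1 ⊆ g ⁻¹' Γ ∧ g ⁻¹' Γ ⊆ bigSquare := by
  obtain ⟨a, ha, b, hb, c, hc, hD, hmax⟩ := exists_max_triangle hc hi
  let L : Pt →ₗ[ℝ] Pt := (LinearMap.fst ℝ ℝ ℝ).smulRight ((1 / 2 : ℝ) • (b - a)) +
    (LinearMap.snd ℝ ℝ ℝ).smulRight ((1 / 2 : ℝ) • (c - a))
  have hL : ∀ p, L p = p.1 • ((1 / 2 : ℝ) • (b - a)) + p.2 • ((1 / 2 : ℝ) • (c - a)) :=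
    fun p => rfl
  have hinj : Function.Injective L := by
    rw [← LinearMap.ker_eq_bot, LinearMap.ker_eq_bot']
    intro p hp
    rw [hL] at hp
    have h₁ := congrArg Prod.fst hp
    have h₂ := congrArg Prod.snd hp
    simp at h₁ h₂
    have e₁ : p.1 * triangleDet a b c = 0 := by
      simp only [triangleDet]; linear_combination 2 * (c.2 - a.2) * h₁ - 2 * (c.1 - a.1) * h₂
    have e₂ : p.2 * triangleDet a b c = 0 := by
      simp only [triangleDet]; linear_combination 2 * (b.1 - a.1) * h₂ - 2 * (b.2 - a.2) * h₁
    ext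
    · exact (mul_eq_zero.1 e₁).resolve_right hD
    · exact (mul_eq_zero.1 e₂).resolve_right hD
  let g : Pt ≃ᵃ[ℝ] Pt := (LinearEquiv.ofInjectiveEndo L hinj).toAffineEquiv.trans
    (AffineEquiv.constVAdd ℝ Pt a)
  have hg : ∀ p, g p = a + (p.1 • ((1 / 2 : ℝ) • (b - a)) + p.2 • ((1 / 2 : ℝ) • (c - a))) :=
    fun p => rfl
  refine ⟨g, fun p hp => ?_, fun p hp => ?_⟩
  · obtain ⟨⟨h₁, h₂⟩, h₃, h₄⟩ := hp
    have hsum := hconv.sum_mem (t := Finset.univ)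
      (w := ![1 - p.1 / 2 - p.2 / 2, p.1 / 2, p.2 / 2]) (z := ![a, b, c])
      (by intro i _; fin_cases i <;> simp <;> linarith)
      (by simp [Fin.sum_univ_three]; ring)
      (by intro i _; fin_cases i <;> simpa)
    rw [mem_preimage, hg]
    convert hsum using 1
    simp only [Fin.sum_univ_three, Matrix.cons_val]
    module
  · have hDpos := abs_pos.2 hD
    have e₁ : triangleDet a b (g p) = p.2 / 2 * triangleDet a b c := by
      simp [hg, triangleDet]; ring
    have e₂ : triangleDet a (g p) c = p.1 / 2 * triangleDet a b c := by
      simp [hg, triangleDet]; ring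
    have key : ∀ s : ℝ, |s / 2 * triangleDet a b c| ≤ |triangleDet a b c| → s ∈ Icc (-2) 2 := by
      intro s hs
      rw [abs_mul] at hs
      have : |s / 2| ≤ 1 := by
        by_contra! h
        nlinarith
      rw [abs_le] at this
      constructor <;> linarith
    exact ⟨key _ (e₂ ▸ hmax a ha _ hp c hc), key _ (e₁ ▸ hmax a ha b hb _ hp)⟩

theorem pow_self_le_three_pow_mul_factorial (n : ℕ) : (n : ℝ) ^ n ≤ 3 ^ n * n.factorial := by
  have h := Real.pow_div_factorial_le_exp (n : ℝ) (Nat.cast_nonneg n) n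
  rw [div_le_iff₀ (by positivity)] at h
  refine h.trans ?_
  rw [← Real.exp_one_pow]
  gcongr
  exact (Real.exp_one_lt_d9.trans (by norm_num)).le

theorem probConvexPos_bounds_of_between {Γ : Set Pt} (hΓ : MeasurableSet Γ)
    (h₁ : Icc (0 : ℝ) 1 ×ˢ Icc (0 : ℝ) 1 ⊆ Γ) (h₂ : Γ ⊆ bigSquare) (n : ℕ) :
    (n.factorial : ℝ) * ((n : ℝ)⁻¹ ^ 3 / 256) ^ n ≤ probConvexPos Γ n ∧
      (n.factorial : ℝ) ^ 2 * probConvexPos Γ n ≤ 2048 ^ n := by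
  have hv₁ : 1 ≤ volume Γ := by
    refine le_of_eq_of_le ?_ (measure_mono h₁)
    rw [Measure.volume_eq_prod, Measure.prod_prod]
    simp
  have hv₂ : volume Γ ≤ 16 := by
    refine (measure_mono h₂).trans_eq ?_
    rw [bigSquare, Measure.volume_eq_prod, Measure.prod_prod, Real.volume_Icc,
      ← ENNReal.ofReal_mul (by norm_num)]
    norm_num
  have h0 : volume Γ ≠ 0 := (zero_lt_one.trans_le hv₁).ne'
  have htop : volume Γ ≠ ⊤ := (hv₂.trans_lt (by simp)).ne
  have := isProbabilityMeasure_unifOn h0 htop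
  have hP : Measure.pi (fun _ : Fin n => unifOn Γ) (convexPosition n) =
      (volume Γ)⁻¹ ^ n * volume (convexPosition n ∩ Set.pi univ fun _ => Γ) := by
    rw [pi_unifOn h0 htop, Measure.smul_apply,
      Measure.restrict_apply' (MeasurableSet.univ_pi fun _ => hΓ), smul_eq_mul]
  have hfin : Measure.pi (fun _ : Fin n => unifOn Γ) (convexPosition n) ≠ ⊤ := measure_ne_top _ _
  have hlow : (n.factorial : ENNReal) * ENNReal.ofReal ((n : ℝ)⁻¹ ^ 3 / 256) ^ n ≤
      Measure.pi (fun _ : Fin n => unifOn Γ) (convexPosition n) := by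
    calc (n.factorial : ENNReal) * ENNReal.ofReal ((n : ℝ)⁻¹ ^ 3 / 256) ^ n
        = (16 : ENNReal)⁻¹ ^ n *
          (n.factorial * ENNReal.ofReal ((n : ℝ)⁻¹ ^ 3 / 16) ^ n) := by
          have : ENNReal.ofReal ((n : ℝ)⁻¹ ^ 3 / 256) =
              (16 : ENNReal)⁻¹ * ENNReal.ofReal ((n : ℝ)⁻¹ ^ 3 / 16) := by
            rw [show (16 : ENNReal) = ENNReal.ofReal 16 by simp,
              ← ENNReal.ofReal_inv_of_pos (by norm_num), ← ENNReal.ofReal_mul (by norm_num)]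
            congr 1
            ring
          rw [this, mul_pow]
          ring
      _ ≤ _ := by
          rw [hP]
          gcongr ?_ ^ n * ?_
          · exact ENNReal.inv_le_inv.2 hv₂
          · exact (le_volume_convexPosition n).trans (measure_mono
              (inter_subset_inter_right _ (Set.pi_mono fun _ _ => h₁)))
  have hupp : (n.factorial : ENNReal) ^ 2 *
      Measure.pi (fun _ : Fin n => unifOn Γ) (convexPosition n) ≤ 2048 ^ n := by
    refine le_trans ?_ (factorial_sq_mul_volume_convexPosition_le n)
    gcongr _ ^ 2 * ?_
    rw [hP]
    refine (mul_le_of_le_one_left' (pow_le_one' (ENNReal.inv_le_one.2 hv₁) n)).trans ?_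
    exact measure_mono (inter_subset_inter_right _ (Set.pi_mono fun _ _ => h₂))
  have hdef : probConvexPos Γ n =
      (Measure.pi (fun _ : Fin n => unifOn Γ) (convexPosition n)).toReal := rfl
  rw [hdef]
  constructor
  · have := ENNReal.toReal_mono hfin hlow
    rwa [ENNReal.toReal_mul, ENNReal.toReal_pow, ENNReal.toReal_ofReal (by positivity),
      ENNReal.toReal_natCast] at this
  · simpa using ENNReal.toReal_mono (by finiteness) hupp

theorem probConvexPos_pow_bounds {Γ : Set Pt} (hc : IsCompact Γ) (hconv : Convex ℝ Γ)
    (hi : (interior Γ).Nonempty) {n : ℕ} (hn : 0 < n) :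
    (1 / 768 / (n : ℝ) ^ 2) ^ n ≤ probConvexPos Γ n ∧
      probConvexPos Γ n ≤ (18432 / (n : ℝ) ^ 2) ^ n := by
  obtain ⟨g, hg₁, hg₂⟩ := exists_affineEquiv_preimage_between hc hconv hi
  have hvol0 : volume Γ ≠ 0 := (Measure.measure_pos_of_nonempty_interior volume hi).ne'
  obtain ⟨hlow, hupp⟩ := probConvexPos_bounds_of_between (Γ := g ⁻¹' Γ)
    ((affineMeasurableEquiv g).measurable hc.measurableSet) hg₁ hg₂ n
  rw [probConvexPos_preimage g hvol0 hc.measure_ne_top] at hlow hupp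
  have hn' : (0 : ℝ) < n := by exact_mod_cast hn
  have hf := pow_self_le_three_pow_mul_factorial n
  constructor
  · refine le_trans ?_ hlow
    calc (1 / 768 / (n : ℝ) ^ 2) ^ n
        = (n : ℝ) ^ n / 3 ^ n * ((n : ℝ)⁻¹ ^ 3 / 256) ^ n := by
          rw [← div_pow, ← mul_pow]
          congr 1
          field_simp
          norm_num
      _ ≤ _ := by
          gcongr
          rw [div_le_iff₀ (by positivity)]
          linarith
  · have h1 : 0 ≤ probConvexPos Γ n := ENNReal.toReal_nonneg
    rw [div_pow, le_div_iff₀ (by positivity)]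
    calc probConvexPos Γ n * ((n : ℝ) ^ 2) ^ n = ((n : ℝ) ^ n) ^ 2 * probConvexPos Γ n := by
          rw [pow_right_comm]; ring
      _ ≤ (3 ^ n * n.factorial) ^ 2 * probConvexPos Γ n := by gcongr
      _ = (3 ^ n) ^ 2 * ((n.factorial : ℝ) ^ 2 * probConvexPos Γ n) := by ring
      _ ≤ (3 ^ n) ^ 2 * 2048 ^ n := by gcongr
      _ = 18432 ^ n := by rw [pow_right_comm, ← mul_pow]; norm_num

/-- Bárány's theorem: there are universal constants `B₁, B₂ > 0` such that
every compact convex planar set `Γ` with nonempty interior and every `n ≥ 3` satisfy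
`B₁ < n² · P(n,Γ)^{1/n} < B₂`. -/
theorem barany_convex_position_bounds :
    ∃ B₁ B₂ : ℝ, 0 < B₁ ∧ 0 < B₂ ∧
      ∀ Γ : Set Pt, IsCompact Γ → Convex ℝ Γ → (interior Γ).Nonempty →
        ∀ n : ℕ, 3 ≤ n →
          B₁ < (n : ℝ) ^ 2 * probConvexPos Γ n ^ ((1 : ℝ) / n) ∧
          (n : ℝ) ^ 2 * probConvexPos Γ n ^ ((1 : ℝ) / n) < B₂ := by
  refine ⟨1 / 1000, 20000, by norm_num, by norm_num, fun Γ hc hconv hi n hn => ?_⟩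
  obtain ⟨hlow, hupp⟩ := probConvexPos_pow_bounds hc hconv hi (n := n) (by omega)
  have hn0 : n ≠ 0 := by omega
  have hn' : (0 : ℝ) < n := by positivity
  have h1 : 0 ≤ probConvexPos Γ n := ENNReal.toReal_nonneg
  have hl := Real.rpow_le_rpow (by positivity) hlow (by positivity : (0 : ℝ) ≤ (n : ℝ)⁻¹)
  have hu := Real.rpow_le_rpow h1 hupp (by positivity : (0 : ℝ) ≤ (n : ℝ)⁻¹)
  rw [Real.pow_rpow_inv_natCast (by positivity) hn0, div_le_iff₀ (by positivity)] at hl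
  rw [Real.pow_rpow_inv_natCast (by positivity) hn0, le_div_iff₀ (by positivity)] at hu
  rw [one_div (n : ℝ), mul_comm]
  constructor <;> linarith
end
end

section
/- Let Γ ⊆ ℝ² be a compact convex set with nonempty interior. For each n let X₁,…,X_n be independent random points each uniformly distributed on Γ, and let X = {X₁,…,X_n}. Then the probability of the event that there exists a subset Y ⊆ X with |Y| ≥ log n whose points are in convex position and such that the interior of the convex hull of Y contains no point of X ∖ Y (an empty convex polygon with at least log n vertices), tends to 0 as n → ∞. -/
open MeasureTheory Set Filter

noncomputable section

/-- Integrating out a product of factors, each depending on a fixed block of coordinates and on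
one further coordinate. -/
lemma lintegral_prod_compl_le_one {ι α : Type*} [Fintype ι] [MeasurableSpace α]
    (μ : Measure α) [IsProbabilityMeasure μ] (P : ι → Prop) [DecidablePred P]
    (H : ({s // P s} → α) → α → ENNReal) (hH : Measurable (Function.uncurry H))
    (hle : ∀ y, ∫⁻ z, H y z ∂μ ≤ 1) :
    ∫⁻ x, ∏ s : {s // ¬ P s}, H (fun t => x t) (x s) ∂(Measure.pi fun _ : ι => μ) ≤ 1 := by
  have hmp := measurePreserving_piEquivPiSubtypeProd (fun _ : ι => μ) P
  have hmeas : Measurable fun w : ({s // P s} → α) × ({s // ¬ P s} → α) =>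
      ∏ s, H w.1 (w.2 s) :=
    Finset.measurable_prod _ fun s _ =>
      hH.comp (measurable_fst.prodMk ((measurable_pi_apply s).comp measurable_snd))
  have h1 := hmp.lintegral_comp hmeas
  calc _ = _ := h1
    _ = ∫⁻ y, ∫⁻ z, ∏ s, H y (z s) ∂(Measure.pi fun _ => μ) ∂(Measure.pi fun _ => μ) :=
      lintegral_prod _ hmeas.aemeasurable
    _ ≤ ∫⁻ _, 1 ∂(Measure.pi fun _ : {s // P s} => μ) := by
      refine lintegral_mono fun y => ?_
      have hy : Measurable (H y) := hH.comp measurable_prodMk_left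
      have hind := ProbabilityTheory.iIndepFun_pi (μ := fun _ : {s // ¬ P s} => μ)
        (X := fun _ => H y) fun _ => hy.aemeasurable
      rw [ProbabilityTheory.lintegral_prod_eq_prod_lintegral_of_indepFun _
        (fun s (z : {s // ¬ P s} → α) => H y (z s)) hind
        fun s => hy.comp (measurable_pi_apply s)]
      refine Finset.prod_le_one' fun s _ => ?_
      have := (measurePreserving_eval (fun _ : {s // ¬ P s} => μ) s).lintegral_comp hy
      exact this.le.trans (hle y)
    _ = 1 := by simp

/-- The determinant of two plane vectors. -/
def planeDet (p q : Pt) : ℝ := p.1 * q.2 - p.2 * q.1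

/-- The affine coordinates of `p` in the frame with origin `a` and axes `b - a`, `c - a`. -/
def frameCoord (a b c p : Pt) : ℝ × ℝ :=
  (planeDet (p - a) (c - a) / planeDet (b - a) (c - a),
    planeDet (b - a) (p - a) / planeDet (b - a) (c - a))

lemma frameCoord_spec {a b c : Pt} (h : planeDet (b - a) (c - a) ≠ 0) (p : Pt) :
    p - a = (frameCoord a b c p).1 • (b - a) + (frameCoord a b c p).2 • (c - a) := by
  have h' := h
  simp only [planeDet, Prod.fst_sub, Prod.snd_sub] at h'
  ext
  · simp only [frameCoord, planeDet, Prod.fst_sub, Prod.snd_sub, Prod.fst_add, Prod.smul_fst,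
      smul_eq_mul]
    rw [div_mul_eq_mul_div, div_mul_eq_mul_div, ← add_div, eq_div_iff h']
    ring
  · simp only [frameCoord, planeDet, Prod.fst_sub, Prod.snd_sub, Prod.snd_add, Prod.smul_snd,
      smul_eq_mul]
    rw [div_mul_eq_mul_div, div_mul_eq_mul_div, ← add_div, eq_div_iff h']
    ring

/-- The points whose coordinates in the frame `a`, `b`, `c` lie in `A`, provided that the frame is
nondegenerate and has its vertices in `Γ`. -/
def frameSet (Γ : Set Pt) (A : Set (ℝ × ℝ)) (a b c : Pt) : Set Pt :=
  {p | a ∈ Γ ∧ b ∈ Γ ∧ c ∈ Γ ∧ planeDet (b - a) (c - a) ≠ 0 ∧ frameCoord a b c p ∈ A}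

lemma measurableSet_frameSet {Γ : Set Pt} {A : Set (ℝ × ℝ)} (hΓ : MeasurableSet Γ)
    (hA : MeasurableSet A) {δ : Type*} [MeasurableSpace δ] {a b c p : δ → Pt}
    (ha : Measurable a) (hb : Measurable b) (hc : Measurable c) (hp : Measurable p) :
    MeasurableSet {w | p w ∈ frameSet Γ A (a w) (b w) (c w)} := by
  have hdet : ∀ {u v : δ → Pt}, Measurable u → Measurable v →
      Measurable fun w => planeDet (u w) (v w) := fun hu hv =>
    (hu.fst.mul hv.snd).sub (hu.snd.mul hv.fst)
  have hD := hdet (hb.sub ha) (hc.sub ha)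
  have hF : Measurable fun w => frameCoord (a w) (b w) (c w) (p w) :=
    ((hdet (hp.sub ha) (hc.sub ha)).div hD).prodMk ((hdet (hb.sub ha) (hp.sub ha)).div hD)
  exact (ha hΓ).inter ((hb hΓ).inter ((hc hΓ).inter
    ((hD (measurableSet_singleton (0 : ℝ)).compl).inter (hF hA))))

lemma volume_frameCoord_preimage {a b c : Pt} (h : planeDet (b - a) (c - a) ≠ 0) :
    ∃ κ : ENNReal, ∀ A : Set (ℝ × ℝ), volume (frameCoord a b c ⁻¹' A) = κ * volume A := by
  let L : Pt →ₗ[ℝ] Pt :=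
    { toFun := fun p => (planeDet p (c - a) / planeDet (b - a) (c - a),
        planeDet (b - a) p / planeDet (b - a) (c - a))
      map_add' := fun p q => by
        ext <;> simp only [planeDet, Prod.fst_add, Prod.snd_add] <;> ring
      map_smul' := fun r p => by
        ext <;> simp only [planeDet, Prod.smul_fst, Prod.smul_snd, smul_eq_mul,
          RingHom.id_apply] <;> ring }
  have hL : ∀ p, frameCoord a b c p = L (p - a) := fun p => rfl
  have hinj : Function.Injective L := by
    rw [injective_iff_map_eq_zero]
    intro p hp
    have h0 := frameCoord_spec h (p + a)
    rw [hL] at h0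
    simpa [hp] using h0
  have hdet : LinearMap.det L ≠ 0 :=
    (LinearEquiv.isUnit_det' (LinearEquiv.ofInjectiveEndo L hinj)).ne_zero
  refine ⟨ENNReal.ofReal |(LinearMap.det L)⁻¹|, fun A => ?_⟩
  rw [← Measure.addHaar_preimage_linearMap volume hdet,
    ← measure_preimage_add_right volume (-a) (L ⁻¹' A)]
  simp only [preimage, hL, sub_eq_add_neg, mem_ofPred_eq]

/-- A small square in the corner of the coordinate triangle. -/
def cornerSquare : Set (ℝ × ℝ) := Ioo 0 (1 / 2) ×ˢ Ioo 0 (1 / 2)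

lemma frameSet_cornerSquare_subset {Γ : Set Pt} {a b c : Pt} :
    frameSet Γ cornerSquare a b c ⊆ convexHull ℝ {a, b, c} := by
  rintro p ⟨-, -, -, hD, ⟨hu0, hu1⟩, ⟨hv0, hv1⟩⟩
  have hp := frameCoord_spec hD p
  set u := (frameCoord a b c p).1
  set v := (frameCoord a b c p).2
  have hp' : p = (1 - u - v) • a + u • b + v • c := by
    rw [← sub_add_cancel p a, hp]
    module
  rw [hp', convexHull_insert (by simp), convexHull_pair]
  have huv : 0 < u + v := add_pos hu0 hv0
  refine mem_convexJoin.2 ⟨a, rfl, (u / (u + v)) • b + (v / (u + v)) • c,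
    ⟨_, _, by positivity, by positivity, by field_simp, rfl⟩,
    ⟨1 - u - v, u + v, by linarith, huv.le, by ring, ?_⟩⟩
  rw [smul_add, smul_smul, smul_smul, mul_div_cancel₀ _ huv.ne', mul_div_cancel₀ _ huv.ne',
    add_assoc]

/-- The weight of a point: at least `100` on the frame set of `A`, at least `1` off the corner
square of the frame. -/
def frameWeight (Γ : Set Pt) (A : Set (ℝ × ℝ)) (a b c p : Pt) : ENNReal :=
  (frameSet Γ cornerSquare a b c)ᶜ.indicator 1 p + 100 * (frameSet Γ A a b c).indicator 1 p

lemma measurableSet_cornerSquare : MeasurableSet cornerSquare :=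
  measurableSet_Ioo.prod measurableSet_Ioo

lemma measurable_frameWeight {Γ : Set Pt} {A : Set (ℝ × ℝ)} (hΓ : MeasurableSet Γ)
    (hA : MeasurableSet A) {δ : Type*} [MeasurableSpace δ] {a b c p : δ → Pt}
    (ha : Measurable a) (hb : Measurable b) (hc : Measurable c) (hp : Measurable p) :
    Measurable fun w => frameWeight Γ A (a w) (b w) (c w) (p w) := by
  have h1 := (measurableSet_frameSet hΓ measurableSet_cornerSquare ha hb hc hp).compl
  have h2 := measurableSet_frameSet hΓ hA ha hb hc hp
  exact ((measurable_const (a := (1 : ENNReal))).indicator h1).add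
    (((measurable_const (a := (1 : ENNReal))).indicator h2).const_mul 100)

lemma isProbabilityMeasure_unifOn_s16 {Γ : Set Pt} (hΓc : IsCompact Γ)
    (hΓint : (interior Γ).Nonempty) : IsProbabilityMeasure (unifOn Γ) := by
  constructor
  rw [unifOn, Measure.smul_apply, Measure.restrict_apply_univ, smul_eq_mul]
  exact ENNReal.inv_mul_cancel (Measure.measure_pos_of_nonempty_interior _ hΓint).ne'
    hΓc.measure_lt_top.ne

lemma lintegral_frameWeight_le_one {Γ : Set Pt} {A : Set (ℝ × ℝ)} (hΓc : IsCompact Γ)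
    (hΓconv : Convex ℝ Γ) (hΓint : (interior Γ).Nonempty) (hA : MeasurableSet A)
    (hvol : 100 * volume A ≤ volume cornerSquare) (a b c : Pt) :
    ∫⁻ p, frameWeight Γ A a b c p ∂(unifOn Γ) ≤ 1 := by
  have := isProbabilityMeasure_unifOn_s16 hΓc hΓint
  have hm : ∀ {B : Set (ℝ × ℝ)}, MeasurableSet B → MeasurableSet (frameSet Γ B a b c) :=
    fun hB => measurableSet_frameSet (δ := Pt) hΓc.measurableSet hB measurable_const
      measurable_const measurable_const measurable_id
  have hO := hm measurableSet_cornerSquare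
  have hU := hm hA
  have key : 100 * unifOn Γ (frameSet Γ A a b c) ≤ unifOn Γ (frameSet Γ cornerSquare a b c) := by
    by_cases hQ : a ∈ Γ ∧ b ∈ Γ ∧ c ∈ Γ ∧ planeDet (b - a) (c - a) ≠ 0
    · obtain ⟨ha, hb, hc, hD⟩ := hQ
      have hset : ∀ B, frameSet Γ B a b c = frameCoord a b c ⁻¹' B := fun B => by
        ext p
        simp [frameSet, ha, hb, hc, hD]
      have hsub : frameSet Γ cornerSquare a b c ⊆ Γ :=
        frameSet_cornerSquare_subset.trans (convexHull_min (by simp [insert_subset_iff, *]) hΓconv)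
      obtain ⟨κ, hκ⟩ := volume_frameCoord_preimage hD
      simp only [unifOn, Measure.smul_apply, smul_eq_mul]
      rw [Measure.restrict_apply hO, inter_eq_self_of_subset_left hsub, mul_left_comm]
      gcongr
      calc 100 * volume.restrict Γ (frameSet Γ A a b c)
          ≤ 100 * volume (frameSet Γ A a b c) := by gcongr; exact Measure.restrict_le_self
        _ = κ * (100 * volume A) := by rw [hset, hκ]; ring
        _ ≤ κ * volume cornerSquare := by gcongr
        _ = _ := by rw [hset, hκ]
    · have hempty : frameSet Γ A a b c = ∅ := by
        ext p
        simp only [frameSet, mem_ofPred_eq, mem_empty_iff_false, iff_false]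
        tauto
      simp [hempty]
  unfold frameWeight
  rw [lintegral_add_left (measurable_one.indicator hO.compl),
    lintegral_const_mul _ (measurable_one.indicator hU), lintegral_indicator_one hO.compl,
    lintegral_indicator_one hU, ← prob_add_prob_compl (μ := unifOn Γ) hO, add_comm]
  gcongr

/-- The index of the cell of the square grid of mesh `1 / g` containing `w`. -/
def cellIndex (g : ℕ) (w : ℝ × ℝ) : ℤ × ℤ := (⌊g * w.1⌋, ⌊g * w.2⌋)

lemma measurable_cellIndex (g : ℕ) : Measurable (cellIndex g) :=
  (measurable_fst.const_mul _).floor.prodMk (measurable_snd.const_mul _).floor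

lemma volume_cellIndex_preimage_le {g : ℕ} (hg : 0 < g) (F : Finset (ℤ × ℤ)) :
    volume (cellIndex g ⁻¹' (F : Set (ℤ × ℤ))) ≤
      F.card * (ENNReal.ofReal (1 / g) * ENNReal.ofReal (1 / g)) := by
  have hg' : (0 : ℝ) < g := by exact_mod_cast hg
  have hsub : cellIndex g ⁻¹' (F : Set (ℤ × ℤ)) ⊆ ⋃ i ∈ F,
      Ico (i.1 / g : ℝ) (i.1 / g + 1 / g) ×ˢ Ico (i.2 / g : ℝ) (i.2 / g + 1 / g) := by
    intro w hw
    refine mem_biUnion hw ?_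
    have key : ∀ x : ℝ, x ∈ Ico ((⌊g * x⌋ : ℝ) / g) ((⌊g * x⌋ : ℝ) / g + 1 / g) := fun x => by
      rw [← add_div, mem_Ico, div_le_iff₀ hg', lt_div_iff₀ hg', mul_comm x]
      exact ⟨Int.floor_le _, Int.lt_floor_add_one _⟩
    exact ⟨key w.1, key w.2⟩
  calc _ ≤ _ := measure_mono hsub
    _ ≤ _ := measure_biUnion_finset_le _ _
    _ = _ := by
      simp only [Measure.volume_eq_prod, Measure.prod_prod, Real.volume_Ico, add_sub_cancel_left,
        Finset.sum_const, nsmul_eq_mul]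

lemma lt_of_floor_mul_lt {g : ℕ} {x y : ℝ} (h : ⌊g * x⌋ < ⌊g * y⌋) : x < y := by
  by_contra! hxy
  exact absurd h (not_lt.2 (Int.floor_mono (by gcongr)))

lemma floor_mul_mem_Icc (g : ℕ) {x : ℝ} (hx : |x| ≤ 1) : ⌊g * x⌋ ∈ Icc (-(g : ℤ)) g := by
  have hg : (0 : ℝ) ≤ g := g.cast_nonneg
  rw [abs_le] at hx
  constructor
  · rw [Int.le_floor]; push_cast; nlinarith
  · rw [← Int.cast_le (R := ℝ)]
    refine (Int.floor_le _).trans ?_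
    push_cast; nlinarith

/-- Points of the square no two of which dominate each other in a fixed pair of orthogonal
directions meet only linearly many cells of the grid. -/
lemma card_image_cellIndex_le_of_antichain {α : Type*} [DecidableEq α] (Z : Finset α)
    (w : α → ℝ × ℝ) (g : ℕ) (hw : ∀ p ∈ Z, |(w p).1| ≤ 1 ∧ |(w p).2| ≤ 1) (σ τ : ℤ)
    (hσ : σ = 1 ∨ σ = -1) (hτ : τ = 1 ∨ τ = -1)
    (hZ : ∀ p ∈ Z, ∀ q ∈ Z,
      ¬ (0 < σ * ((w q).1 - (w p).1) ∧ 0 < τ * ((w q).2 - (w p).2))) :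
    (Z.image fun p => cellIndex g (w p)).card ≤ 4 * g + 1 := by
  have hcard : (Finset.Icc (-(2 * g : ℤ)) (2 * g)).card = 4 * g + 1 := by
    rw [Int.card_Icc]; omega
  rw [← hcard]
  refine Finset.card_le_card_of_injOn (fun i => σ * i.1 - τ * i.2) ?_ ?_
  · simp only [Finset.coe_image, mapsTo_image_iff]
    intro p hp
    obtain ⟨h1, h2⟩ := hw p hp
    have h1 := floor_mul_mem_Icc g h1
    have h2 := floor_mul_mem_Icc g h2
    simp only [Function.comp, cellIndex, Finset.coe_Icc, mem_Icc] at h1 h2 ⊢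
    rcases hσ with rfl | rfl <;> rcases hτ with rfl | rfl <;> constructor <;> omega
  · simp only [Finset.coe_image]
    rintro _ ⟨p, hp, rfl⟩ _ ⟨q, hq, rfl⟩ h
    have h1 := hZ p hp q hq
    have h2 := hZ q hq p hp
    have hx : ⌊g * (w p).1⌋ < ⌊g * (w q).1⌋ → (w p).1 < (w q).1 := lt_of_floor_mul_lt
    have hx' : ⌊g * (w q).1⌋ < ⌊g * (w p).1⌋ → (w q).1 < (w p).1 := lt_of_floor_mul_lt
    have hy : ⌊g * (w p).2⌋ < ⌊g * (w q).2⌋ → (w p).2 < (w q).2 := lt_of_floor_mul_lt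
    have hy' : ⌊g * (w q).2⌋ < ⌊g * (w p).2⌋ → (w q).2 < (w p).2 := lt_of_floor_mul_lt
    simp only [cellIndex] at h ⊢
    by_contra hne
    rw [Prod.mk.injEq] at hne
    rcases hσ with rfl | rfl <;> rcases hτ with rfl | rfl <;> norm_num at h1 h2 h <;>
    · rcases lt_trichotomy ⌊g * (w p).1⌋ ⌊g * (w q).1⌋ with hlt | heq | hlt
      · have h3 := hx hlt
        first
        | linarith [h1 h3, hy (by omega)]
        | linarith [h1 h3, hy' (by omega)]
        | linarith [h2 h3, hy (by omega)]
        | linarith [h2 h3, hy' (by omega)]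
      · exact hne ⟨heq, by omega⟩
      · have h3 := hx' hlt
        first
        | linarith [h1 h3, hy (by omega)]
        | linarith [h1 h3, hy' (by omega)]
        | linarith [h2 h3, hy (by omega)]
        | linarith [h2 h3, hy' (by omega)]

lemma card_image_cellIndex_le {α : Type*} [DecidableEq α] (Y : Finset α)
    (w : α → ℝ × ℝ) (g : ℕ) (hw : ∀ p ∈ Y, |(w p).1| ≤ 1 ∧ |(w p).2| ≤ 1)
    (hsup : ∀ p ∈ Y, ∃ r s : ℝ, ∀ q ∈ Y, q ≠ p →
      r * ((w q).1 - (w p).1) + s * ((w q).2 - (w p).2) < 0) :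
    (Y.image fun p => cellIndex g (w p)).card ≤ 4 * (4 * g + 1) := by
  classical
  let Z : ℤ → ℤ → Finset α := fun σ τ => Y.filter fun p => ∀ q ∈ Y,
    ¬ (0 < σ * ((w q).1 - (w p).1) ∧ 0 < τ * ((w q).2 - (w p).2))
  have hcov : Y ⊆ (Z 1 1 ∪ Z 1 (-1)) ∪ (Z (-1) 1 ∪ Z (-1) (-1)) := by
    intro p hp
    obtain ⟨r, s, hrs⟩ := hsup p hp
    have key : ∀ σ τ : ℤ, 0 ≤ σ * r → 0 ≤ τ * s → (σ = 1 ∨ σ = -1) → (τ = 1 ∨ τ = -1) →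
        p ∈ Z σ τ := by
      intro σ τ hr hs hσ hτ
      refine Finset.mem_filter.2 ⟨hp, fun q hq ⟨h1, h2⟩ => ?_⟩
      have hne : q ≠ p := by
        rintro rfl
        simp at h1
      have h3 := hrs q hq hne
      have h4 := mul_nonneg hr h1.le
      have h5 := mul_nonneg hs h2.le
      rcases hσ with rfl | rfl <;> rcases hτ with rfl | rfl <;> push_cast at h4 h5 <;> linarith
    simp only [Finset.mem_union]
    rcases le_total 0 r with hr | hr <;> rcases le_total 0 s with hs | hs
    · exact Or.inl (Or.inl (key 1 1 (by simpa) (by simpa) (by simp) (by simp)))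
    · exact Or.inl (Or.inr (key 1 (-1) (by simpa) (by simpa) (by simp) (by simp)))
    · exact Or.inr (Or.inl (key (-1) 1 (by simpa) (by simpa) (by simp) (by simp)))
    · exact Or.inr (Or.inr (key (-1) (-1) (by simpa) (by simpa) (by simp) (by simp)))
  have hZ : ∀ σ τ : ℤ, (σ = 1 ∨ σ = -1) → (τ = 1 ∨ τ = -1) →
      ((Z σ τ).image fun p => cellIndex g (w p)).card ≤ 4 * g + 1 := fun σ τ hσ hτ =>
    card_image_cellIndex_le_of_antichain _ w g (fun p hp => hw p (Finset.mem_filter.1 hp).1)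
      σ τ hσ hτ fun p hp q hq => (Finset.mem_filter.1 hp).2 q (Finset.mem_filter.1 hq).1
  have h1 := hZ 1 1 (by simp) (by simp)
  have h2 := hZ 1 (-1) (by simp) (by simp)
  have h3 := hZ (-1) 1 (by simp) (by simp)
  have h4 := hZ (-1) (-1) (by simp) (by simp)
  have h5 := Finset.card_le_card (Finset.image_subset_image
    (f := fun p => cellIndex g (w p)) hcov)
  simp only [Finset.image_union] at h5
  have h6 := Finset.card_union_le
    ((Z 1 1).image (fun p => cellIndex g (w p)) ∪ (Z 1 (-1)).image fun p => cellIndex g (w p))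
    ((Z (-1) 1).image (fun p => cellIndex g (w p)) ∪ (Z (-1) (-1)).image fun p => cellIndex g (w p))
  have h7 := Finset.card_union_le
    ((Z 1 1).image fun p => cellIndex g (w p)) ((Z 1 (-1)).image fun p => cellIndex g (w p))
  have h8 := Finset.card_union_le
    ((Z (-1) 1).image fun p => cellIndex g (w p)) ((Z (-1) (-1)).image fun p => cellIndex g (w p))
  omega

lemma notMem_convexHull_sdiff_of_mem_extremePoints {Y : Set Pt} {p : Pt}
    (hp : p ∈ extremePoints ℝ (convexHull ℝ Y)) :
    p ∉ convexHull ℝ (Y \ {p}) := fun h =>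
  ((Convex.mem_extremePoints_iff_mem_sdiff_convexHull_sdiff (𝕜 := ℝ)
    (convex_convexHull ℝ Y)).1 hp).2
    (convexHull_mono (𝕜 := ℝ) (sdiff_subset_sdiff_left (subset_convexHull ℝ Y)) h)

lemma exists_strict_support {Y : Set Pt} (hY : Y.Finite) {p : Pt}
    (hp : p ∉ convexHull ℝ (Y \ {p})) :
    ∃ f : Pt →L[ℝ] ℝ, ∀ q ∈ Y, q ≠ p → f q < f p := by
  obtain ⟨f, u, h1, h2⟩ := geometric_hahn_banach_closed_point (convex_convexHull ℝ (Y \ {p}))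
    ((hY.subset sdiff_subset).isClosed_convexHull ℝ) hp
  exact ⟨f, fun q hq hqp => (h1 q (subset_convexHull ℝ _ ⟨hq, hqp⟩)).trans h2⟩

lemma planeDet_ne_zero_of_convexPosition {Y : Set Pt}
    (hY : ∀ p ∈ Y, p ∉ convexHull ℝ (Y \ {p})) {a b c : Pt} (ha : a ∈ Y) (hb : b ∈ Y)
    (hc : c ∈ Y) (hab : a ≠ b) (hac : a ≠ c) (hbc : b ≠ c) :
    planeDet (b - a) (c - a) ≠ 0 := by
  intro hD
  have hno : ∀ {x y z : Pt}, x ∈ Y → y ∈ Y → z ∈ Y → x ≠ y → z ≠ y → ¬ Wbtw ℝ x y z := by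
    intro x y z hx hy hz hxy hzy h
    refine hY y hy (segment_subset_convexHull (s := Y \ {y}) ⟨hx, hxy⟩ ⟨hz, hzy⟩ ?_)
    exact mem_segment_iff_wbtw.2 h
  have hcol : Collinear ℝ ({a, b, c} : Set Pt) := by
    rw [collinear_iff_of_mem (p₀ := a) (by simp)]
    refine ⟨b - a, ?_⟩
    simp only [mem_insert_iff, mem_singleton_iff, forall_eq_or_imp, forall_eq]
    refine ⟨⟨0, by simp⟩, ⟨1, by simp⟩, ?_⟩
    simp only [planeDet, Prod.fst_sub, Prod.snd_sub] at hD
    by_cases h1 : b.1 - a.1 = 0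
    · have h2 : b.2 - a.2 ≠ 0 := fun h2 =>
        hab (Prod.ext (sub_eq_zero.1 h1).symm (sub_eq_zero.1 h2).symm)
      refine ⟨(c.2 - a.2) / (b.2 - a.2), Prod.ext ?_ ?_⟩
      · rw [h1, zero_mul, zero_sub, neg_eq_zero, mul_eq_zero] at hD
        simpa [h1] using sub_eq_zero.1 (hD.resolve_left h2)
      · simp [div_mul_cancel₀ _ h2]
    · refine ⟨(c.1 - a.1) / (b.1 - a.1), Prod.ext ?_ ?_⟩
      · simp [div_mul_cancel₀ _ h1]
      · simp only [vadd_eq_add, Prod.snd_add, Prod.smul_snd, Prod.snd_sub, smul_eq_mul]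
        rw [← sub_eq_iff_eq_add, div_mul_eq_mul_div, eq_div_iff h1]
        linarith
  rcases hcol.wbtw_or_wbtw_or_wbtw with h | h | h
  · exact hno ha hb hc hab hbc.symm h
  · exact hno hb hc ha hbc hac h
  · exact hno hc ha hb hac.symm hab.symm h

/-- A convex polygon has a frame of three of its vertices in which all vertices have coordinates
bounded by one. -/
lemma exists_frame {Y : Finset Pt} (hcard : 3 ≤ Y.card)
    (hY : ∀ p ∈ Y, p ∉ convexHull ℝ ((Y : Set Pt) \ {p})) :
    ∃ a ∈ Y, ∃ b ∈ Y, ∃ c ∈ Y, planeDet (b - a) (c - a) ≠ 0 ∧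
      ∀ p ∈ Y, |(frameCoord a b c p).1| ≤ 1 ∧ |(frameCoord a b c p).2| ≤ 1 := by
  obtain ⟨a₀, b₀, c₀, ha₀, hb₀, hc₀, hab, hac, hbc⟩ := Finset.two_lt_card_iff.1 hcard
  obtain ⟨⟨a, b, c⟩, hmem, hmax⟩ := Finset.exists_max_image (Y ×ˢ Y ×ˢ Y)
    (fun t => |planeDet (t.2.1 - t.1) (t.2.2 - t.1)|) ⟨(a₀, b₀, c₀), by simp [ha₀, hb₀, hc₀]⟩
  simp only [Finset.mem_product] at hmem
  obtain ⟨ha, hb, hc⟩ := hmem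
  have hpos : 0 < |planeDet (b - a) (c - a)| :=
    (abs_pos.2 (planeDet_ne_zero_of_convexPosition hY ha₀ hb₀ hc₀ hab hac hbc)).trans_le
      (hmax (a₀, b₀, c₀) (by simp [ha₀, hb₀, hc₀]))
  refine ⟨a, ha, b, hb, c, hc, abs_pos.1 hpos, fun p hp => ⟨?_, ?_⟩⟩
  · rw [frameCoord, abs_div, div_le_one hpos]
    exact hmax (a, p, c) (by simp [ha, hp, hc])
  · rw [frameCoord, abs_div, div_le_one hpos]
    exact hmax (a, b, p) (by simp [ha, hp, hb])

/-- In a bounded frame, the vertices of a convex polygon meet few cells of the grid. -/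
lemma card_image_cellIndex_frameCoord_le {Y : Finset Pt}
    (hY : ∀ p ∈ Y, p ∉ convexHull ℝ ((Y : Set Pt) \ {p})) {a b c : Pt}
    (hD : planeDet (b - a) (c - a) ≠ 0)
    (hbd : ∀ p ∈ Y, |(frameCoord a b c p).1| ≤ 1 ∧ |(frameCoord a b c p).2| ≤ 1) (g : ℕ) :
    (Y.image fun p => cellIndex g (frameCoord a b c p)).card ≤ 4 * (4 * g + 1) := by
  refine card_image_cellIndex_le Y _ g hbd fun p hp => ?_
  obtain ⟨f, hf⟩ := exists_strict_support Y.finite_toSet (hY p hp)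
  refine ⟨f (b - a), f (c - a), fun q hq hqp => ?_⟩
  have key : ∀ x, f x - f a =
      (frameCoord a b c x).1 * f (b - a) + (frameCoord a b c x).2 * f (c - a) := fun x => by
    rw [← map_sub, frameCoord_spec hD x, map_add, map_smul, map_smul, smul_eq_mul, smul_eq_mul]
  have h1 := key p
  have h2 := key q
  have h3 := hf q hq hqp
  linarith

/-- The sets of cells that the vertices of a convex polygon may meet in a bounded frame. -/
def cellFamily (g : ℕ) : Finset (Finset (ℤ × ℤ)) :=
  {F ∈ (Finset.Icc (-(g : ℤ)) g ×ˢ Finset.Icc (-(g : ℤ)) g).powerset | F.card ≤ 4 * (4 * g + 1)}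

lemma volume_cellIndex_preimage_of_mem_cellFamily {g : ℕ} (hg : 8000 ≤ g) {F : Finset (ℤ × ℤ)}
    (hF : F ∈ cellFamily g) :
    100 * volume (cellIndex g ⁻¹' (F : Set (ℤ × ℤ))) ≤ volume cornerSquare := by
  have hcard : (F.card : ℝ) ≤ 4 * (4 * g + 1) := by exact_mod_cast (Finset.mem_filter.1 hF).2
  have hg' : (8000 : ℝ) ≤ g := by exact_mod_cast hg
  have hg0 : (0 : ℝ) < g := by linarith
  have hreal : 100 * ((F.card : ℝ) * (1 / g * (1 / g))) ≤ 1 / 2 * (1 / 2) := by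
    have h : 100 * ((F.card : ℝ) * (1 / g * (1 / g))) = 100 * F.card / (g * g) := by
      field_simp
    rw [h, div_le_iff₀ (by positivity)]
    nlinarith
  calc 100 * volume (cellIndex g ⁻¹' (F : Set (ℤ × ℤ)))
      ≤ 100 * (F.card * (ENNReal.ofReal (1 / g) * ENNReal.ofReal (1 / g))) := by
        gcongr
        exact volume_cellIndex_preimage_le (by omega) F
    _ = ENNReal.ofReal (100 * ((F.card : ℝ) * (1 / g * (1 / g)))) := by
        rw [ENNReal.ofReal_mul (by norm_num), ENNReal.ofReal_mul (by positivity),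
          ENNReal.ofReal_mul (by positivity), ENNReal.ofReal_natCast, ENNReal.ofReal_ofNat]
    _ ≤ ENNReal.ofReal (1 / 2 * (1 / 2)) := ENNReal.ofReal_le_ofReal hreal
    _ = volume cornerSquare := by
        rw [cornerSquare, Measure.volume_eq_prod, Measure.prod_prod, Real.volume_Ioo, sub_zero,
          ← ENNReal.ofReal_mul (by norm_num)]

lemma pow_le_prod_of_one_le {κ : Type*} [Fintype κ] (S : Finset κ) (h : κ → ENNReal) {K : ENNReal}
    (h1 : ∀ s, 1 ≤ h s) (hS : ∀ s ∈ S, K ≤ h s) : K ^ S.card ≤ ∏ s, h s :=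
  calc K ^ S.card = ∏ _s ∈ S, K := (Finset.prod_const K).symm
    _ ≤ ∏ s ∈ S, h s := Finset.prod_le_prod' hS
    _ ≤ ∏ s, h s := Finset.prod_le_prod_of_subset_of_one_le' (Finset.subset_univ S) fun s _ _ => h1 s

/-- An empty convex polygon with many vertices makes the product of the weights large in one of
the frames spanned by three sample points. -/
lemma exists_pow_le_prod_frameWeight {ι : Type*} [Fintype ι] [DecidableEq ι] {Γ : Set Pt}
    {x : ι → Pt} (hx : ∀ i, x i ∈ Γ) {Y : Finset Pt} (hYx : Y ⊆ Finset.image x Finset.univ)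
    (hcard : 3 ≤ Y.card) (hY : ∀ p ∈ Y, p ∈ extremePoints ℝ (convexHull ℝ (Y : Set Pt)))
    (hempty : (((Finset.image x Finset.univ \ Y : Finset Pt) : Set Pt) ∩
      interior (convexHull ℝ (Y : Set Pt))) = ∅) (g : ℕ) :
    ∃ i j l : ι, ∃ F ∈ cellFamily g, (100 : ENNReal) ^ (Y.card - 3) ≤
      ∏ s : {s // ¬ (s = i ∨ s = j ∨ s = l)},
        frameWeight Γ (cellIndex g ⁻¹' (F : Set (ℤ × ℤ))) (x i) (x j) (x l) (x s) := by
  have hY' : ∀ p ∈ Y, p ∉ convexHull ℝ ((Y : Set Pt) \ {p}) := fun p hp =>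
    notMem_convexHull_sdiff_of_mem_extremePoints (hY p hp)
  obtain ⟨a, ha, b, hb, c, hc, hD, hbd⟩ := exists_frame hcard hY'
  obtain ⟨i, -, rfl⟩ := Finset.mem_image.1 (hYx ha)
  obtain ⟨j, -, rfl⟩ := Finset.mem_image.1 (hYx hb)
  obtain ⟨l, -, rfl⟩ := Finset.mem_image.1 (hYx hc)
  set F := Y.image fun p => cellIndex g (frameCoord (x i) (x j) (x l) p) with hF
  have hFmem : F ∈ cellFamily g := by
    refine Finset.mem_filter.2 ⟨Finset.mem_powerset.2 ?_,
      card_image_cellIndex_frameCoord_le hY' hD hbd g⟩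
    refine Finset.image_subset_iff.2 fun p hp => ?_
    simp only [Finset.mem_product, Finset.mem_Icc]
    exact ⟨floor_mul_mem_Icc g (hbd p hp).1, floor_mul_mem_Icc g (hbd p hp).2⟩
  refine ⟨i, j, l, F, hFmem, ?_⟩
  have hYU : ∀ p ∈ Y, p ∈ frameSet Γ (cellIndex g ⁻¹' (F : Set (ℤ × ℤ))) (x i) (x j) (x l) :=
    fun p hp => ⟨hx i, hx j, hx l, hD, Finset.mem_coe.2 (Finset.mem_image_of_mem _ hp)⟩
  have hOint : frameSet Γ cornerSquare (x i) (x j) (x l) ⊆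
      interior (convexHull ℝ (Y : Set Pt)) := by
    refine interior_maximal (frameSet_cornerSquare_subset.trans
      (convexHull_mono (by simp [insert_subset_iff, ha, hb, hc]))) ?_
    have hset : frameSet Γ cornerSquare (x i) (x j) (x l) =
        frameCoord (x i) (x j) (x l) ⁻¹' cornerSquare := by
      ext p
      simp [frameSet, hx, hD]
    rw [hset]
    refine (isOpen_Ioo.prod isOpen_Ioo).preimage ?_
    unfold frameCoord planeDet
    fun_prop
  have hYO : ∀ p ∈ Y, p ∉ frameSet Γ cornerSquare (x i) (x j) (x l) := by
    intro p hp hpO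
    have hcorner := hpO.2.2.2.2
    have hne : ∀ q : Pt, (frameCoord (x i) (x j) (x l) q).1 = 0 ∨
        (frameCoord (x i) (x j) (x l) q).2 = 0 → q ≠ p := by
      rintro q h rfl
      rcases h with h | h
      · exact hcorner.1.1.ne' h
      · exact hcorner.2.1.ne' h
    have h1 : x i ≠ p := hne _ (by simp [frameCoord, planeDet])
    have h2 : x j ≠ p := hne _ (Or.inr (by simp [frameCoord, planeDet, mul_comm]))
    have h3 : x l ≠ p := hne _ (Or.inl (by simp [frameCoord, planeDet, mul_comm]))
    refine hY' p hp (convexHull_mono ?_ (frameSet_cornerSquare_subset hpO))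
    simp only [insert_subset_iff, singleton_subset_iff]
    exact ⟨⟨ha, h1⟩, ⟨hb, h2⟩, ⟨hc, h3⟩⟩
  have hO : ∀ s, x s ∉ frameSet Γ cornerSquare (x i) (x j) (x l) := by
    intro s hs
    by_cases hsY : x s ∈ Y
    · exact hYO _ hsY hs
    · have : x s ∈ (((Finset.image x Finset.univ \ Y : Finset Pt) : Set Pt) ∩
          interior (convexHull ℝ (Y : Set Pt))) := ⟨by simp [hsY], hOint hs⟩
      rw [hempty] at this
      exact this
  let S : Finset {s // ¬ (s = i ∨ s = j ∨ s = l)} := {s | x s ∈ Y}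
  have hScard : Y.card - 3 ≤ S.card := by
    have hsub : Y ⊆ S.image (fun s => x s.1) ∪ {x i, x j, x l} := by
      intro p hp
      obtain ⟨s, -, rfl⟩ := Finset.mem_image.1 (hYx hp)
      by_cases hs : s = i ∨ s = j ∨ s = l
      · refine Finset.mem_union_right _ ?_
        rcases hs with rfl | rfl | rfl <;> simp
      · exact Finset.mem_union_left _ (Finset.mem_image.2 ⟨⟨s, hs⟩, by simpa [S] using hp, rfl⟩)
    have h1 := (Finset.card_le_card hsub).trans (Finset.card_union_le _ _)
    have h2 : (S.image fun s => x s.1).card ≤ S.card := Finset.card_image_le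
    have h3 : ({x i, x j, x l} : Finset Pt).card ≤ 3 := Finset.card_le_three
    omega
  have hone : ∀ s, 1 ≤ frameWeight Γ (cellIndex g ⁻¹' (F : Set (ℤ × ℤ)))
      (x i) (x j) (x l) (x s) := fun s => by
    rw [frameWeight, indicator_of_mem (hO s)]
    exact le_self_add
  refine (pow_le_pow_right₀ (by norm_num) hScard).trans
    (pow_le_prod_of_one_le S _ (fun s => hone s) fun s hs => ?_)
  rw [frameWeight, indicator_of_mem (hYU _ (Finset.mem_filter.1 hs).2)]
  simp

lemma measure_pow_le_prod_frameWeight_le {ι : Type*} [Fintype ι] [DecidableEq ι] {Γ : Set Pt}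
    {A : Set (ℝ × ℝ)} (hΓc : IsCompact Γ) (hΓconv : Convex ℝ Γ) (hΓint : (interior Γ).Nonempty)
    (hA : MeasurableSet A) (hvol : 100 * volume A ≤ volume cornerSquare) (i j l : ι) (k : ℕ) :
    Measure.pi (fun _ : ι => unifOn Γ) {x | (100 : ENNReal) ^ k ≤
      ∏ s : {s // ¬ (s = i ∨ s = j ∨ s = l)}, frameWeight Γ A (x i) (x j) (x l) (x s)} ≤
      ((100 : ENNReal) ^ k)⁻¹ := by
  have := isProbabilityMeasure_unifOn_s16 hΓc hΓint
  have hmeas : Measurable fun x : ι → Pt =>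
      ∏ s : {s // ¬ (s = i ∨ s = j ∨ s = l)}, frameWeight Γ A (x i) (x j) (x l) (x s) :=
    Finset.measurable_prod _ fun s _ => measurable_frameWeight hΓc.measurableSet hA
      (measurable_pi_apply _) (measurable_pi_apply _) (measurable_pi_apply _)
      (measurable_pi_apply _)
  rw [ENNReal.le_inv_iff_mul_le, mul_comm]
  refine (mul_meas_ge_le_lintegral hmeas _).trans ?_
  let P : ι → Prop := fun s => s = i ∨ s = j ∨ s = l
  exact lintegral_prod_compl_le_one (unifOn Γ) P
    (fun y p => frameWeight Γ A (y ⟨i, Or.inl rfl⟩) (y ⟨j, Or.inr (Or.inl rfl)⟩)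
      (y ⟨l, Or.inr (Or.inr rfl)⟩) p)
    (measurable_frameWeight hΓc.measurableSet hA
      ((measurable_pi_apply _).comp measurable_fst) ((measurable_pi_apply _).comp measurable_fst)
      ((measurable_pi_apply _).comp measurable_fst) measurable_snd)
    fun y => lintegral_frameWeight_le_one hΓc hΓconv hΓint hA hvol _ _ _

lemma natCast_pow_four_le_pow_ceil_log {n : ℕ} (hn : 0 < n) :
    (n : ENNReal) ^ 4 ≤ 100 ^ ⌈Real.log n⌉₊ := by
  have hn' : (0 : ℝ) < n := by exact_mod_cast hn
  have hexp : Real.exp 4 ≤ 100 := by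
    have h : Real.exp 4 = Real.exp 1 ^ 4 := by rw [← Real.exp_nat_mul]; norm_num
    rw [h]
    calc Real.exp 1 ^ 4 ≤ 3 ^ 4 := by gcongr; linarith [Real.exp_one_lt_d9]
      _ ≤ 100 := by norm_num
  have hreal : (n : ℝ) ^ 4 ≤ 100 ^ ⌈Real.log n⌉₊ :=
    calc (n : ℝ) ^ 4 = Real.exp (Real.log n * 4) := by
          rw [mul_comm, show (4 : ℝ) * Real.log n = (4 : ℕ) * Real.log n by norm_num,
            Real.exp_nat_mul, Real.exp_log hn']
      _ ≤ Real.exp (⌈Real.log n⌉₊ * 4) := by gcongr; exact Nat.le_ceil _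
      _ = Real.exp 4 ^ ⌈Real.log n⌉₊ := Real.exp_nat_mul _ _
      _ ≤ 100 ^ ⌈Real.log n⌉₊ := by gcongr
  exact_mod_cast hreal

/-- Corollary: for `n` i.i.d. uniform points in a compact convex set with
nonempty interior, the probability that some subset of at least `log n` of the points is in
convex position with no other sampled point inside its convex hull tends to `0`. -/
theorem no_large_empty_convex_polygon (Γ : Set Pt) (hΓc : IsCompact Γ)
    (hΓconv : Convex ℝ Γ) (hΓint : (interior Γ).Nonempty) :
    Tendsto (fun n : ℕ =>
      Measure.pi (fun _ : Fin n => unifOn Γ)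
        {x : Fin n → Pt |
          ∃ Y : Finset Pt, Y ⊆ Finset.image x Finset.univ ∧
            Real.log n ≤ Y.card ∧
            (∀ p ∈ Y, p ∈ Set.extremePoints ℝ (convexHull ℝ (Y : Set Pt))) ∧
            (((Finset.image x Finset.univ \ Y : Finset Pt) : Set Pt) ∩
              interior (convexHull ℝ (Y : Set Pt))) = ∅})
      atTop (nhds 0) := by
  classical
  have := isProbabilityMeasure_unifOn_s16 hΓc hΓint
  obtain ⟨g, hg⟩ : ∃ g : ℕ, 8000 ≤ g := ⟨8000, le_rfl⟩
  set C : ENNReal := (cellFamily g).card * 100 ^ 3 with hC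
  have hlim : Tendsto (fun n : ℕ => C * (n : ENNReal)⁻¹) atTop (nhds 0) := by
    have h := ENNReal.Tendsto.const_mul (a := C) ENNReal.tendsto_inv_nat_nhds_zero
      (Or.inr (ENNReal.mul_ne_top (ENNReal.natCast_ne_top _) (by finiteness)))
    rwa [mul_zero] at h
  have hlog : ∀ᶠ n : ℕ in atTop, (3 : ℝ) ≤ Real.log n :=
    (Real.tendsto_log_atTop.comp tendsto_natCast_atTop_atTop).eventually_ge_atTop 3
  refine tendsto_of_tendsto_of_tendsto_of_le_of_le' tendsto_const_nhds hlim
    (Eventually.of_forall fun _ => zero_le) ?_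
  filter_upwards [hlog, eventually_gt_atTop 0] with n hn hn0
  set K := ⌈Real.log n⌉₊
  have hK : 3 ≤ K := by
    have : (3 : ℝ) ≤ K := hn.trans (Nat.le_ceil _)
    exact_mod_cast this
  let I : Finset ((Fin n × Fin n × Fin n) × Finset (ℤ × ℤ)) := Finset.univ ×ˢ cellFamily g
  let B : (Fin n × Fin n × Fin n) × Finset (ℤ × ℤ) → Set (Fin n → Pt) := fun t =>
    {x | (100 : ENNReal) ^ (K - 3) ≤
      ∏ s : {s // ¬ (s = t.1.1 ∨ s = t.1.2.1 ∨ s = t.1.2.2)},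
        frameWeight Γ (cellIndex g ⁻¹' (t.2 : Set (ℤ × ℤ)))
          (x t.1.1) (x t.1.2.1) (x t.1.2.2) (x s)}
  have hmemΓ : ∀ᵐ x ∂Measure.pi (fun _ : Fin n => unifOn Γ), ∀ i, x i ∈ Γ := by
    refine ae_all_iff.2 fun i => Measure.tendsto_eval_ae_ae.eventually ?_
    exact Measure.ae_smul_measure (ae_restrict_mem hΓc.measurableSet) _
  calc _ ≤ Measure.pi (fun _ : Fin n => unifOn Γ) (⋃ t ∈ I, B t) := by
        refine measure_mono_ae ?_
        filter_upwards [hmemΓ] with x hx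
        rintro ⟨Y, hYx, hYcard, hYext, hYempty⟩
        have hKY : K ≤ Y.card := Nat.ceil_le.2 hYcard
        obtain ⟨i, j, l, F, hF, hle⟩ := exists_pow_le_prod_frameWeight hx hYx (hK.trans hKY)
          hYext hYempty g
        refine mem_biUnion (x := ((i, j, l), F)) (by simpa [I] using hF) ?_
        exact (pow_le_pow_right₀ (by norm_num) (by omega)).trans hle
    _ ≤ ∑ t ∈ I, Measure.pi (fun _ : Fin n => unifOn Γ) (B t) := measure_biUnion_finset_le _ _
    _ ≤ ∑ _t ∈ I, ((100 : ENNReal) ^ (K - 3))⁻¹ := by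
        refine Finset.sum_le_sum fun t ht => ?_
        have hF : t.2 ∈ cellFamily g := (Finset.mem_product.1 ht).2
        exact measure_pow_le_prod_frameWeight_le hΓc hΓconv hΓint
          (measurable_cellIndex _ t.2.measurableSet)
          (volume_cellIndex_preimage_of_mem_cellFamily hg hF) _ _ _ _
    _ = (n : ENNReal) ^ 3 * (cellFamily g).card * ((100 : ENNReal) ^ (K - 3))⁻¹ := by
        simp only [I, Finset.sum_const, nsmul_eq_mul, Finset.card_product, Finset.card_univ,
          Fintype.card_prod, Fintype.card_fin]
        push_cast
        ring
    _ ≤ (n : ENNReal) ^ 3 * (cellFamily g).card * (100 ^ 3 * ((n : ENNReal) ^ 4)⁻¹) := by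
        gcongr
        have hpow : (100 : ENNReal) ^ K = 100 ^ 3 * 100 ^ (K - 3) := by
          rw [← pow_add]; congr 1; omega
        calc ((100 : ENNReal) ^ (K - 3))⁻¹ = 100 ^ 3 * (100 ^ K)⁻¹ := by
              rw [hpow, ENNReal.mul_inv (by simp) (by simp), ← mul_assoc,
                ENNReal.mul_inv_cancel (by simp) (by finiteness), one_mul]
          _ ≤ 100 ^ 3 * ((n : ENNReal) ^ 4)⁻¹ :=
              mul_le_mul_right (ENNReal.inv_le_inv.2 (natCast_pow_four_le_pow_ceil_log hn0)) _
    _ = C * ((n : ENNReal) ^ 3 * ((n : ENNReal) ^ 4)⁻¹) := by rw [hC]; ring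
    _ = C * (n : ENNReal)⁻¹ := by
        have h0 : (n : ENNReal) ^ 3 ≠ 0 := by simp [hn0.ne']
        have h1 : (n : ENNReal) ^ 3 ≠ ⊤ := by finiteness
        rw [pow_succ (n : ENNReal) 3, ENNReal.mul_inv (Or.inl h0) (Or.inl h1),
          ENNReal.mul_inv_cancel_left h0 h1]
end
end

section
/- Let Γ ⊆ ℝ² be a compact convex set of diameter 1, let M be a positive integer, and let K ⊆ Γ be a closed convex set of area S. If S > 100/M, then there exists a triangle T with all three vertices in the lattice (1/M)·ℤ² such that K ⊆ T, the area of T is at most 64·S, and the diameter of T is at most 12. If S ≤ 100/M, then there exists a triangle T with all three vertices in (1/M)·ℤ² such that K ⊆ T, the area of T is at most 6400/M, and the diameter of T is at most 12. -/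
open MeasureTheory Set Filter

noncomputable section

/-- The square lattice with spacing `1/M`. -/
def latticePts (M : ℕ) : Set Pt := {p | ∃ a b : ℤ, p = ((a : ℝ) / M, (b : ℝ) / M)}

/-- Twice the signed area of the triangle `p q r`. -/
def triDet (p q r : Pt) : ℝ := (q.1 - p.1) * (r.2 - p.2) - (q.2 - p.2) * (r.1 - p.1)

lemma mem_convexHull_triple {p q r x : Pt} :
    x ∈ convexHull ℝ ({p, q, r} : Set Pt) ↔
      ∃ u v : ℝ, 0 ≤ u ∧ 0 ≤ v ∧ u + v ≤ 1 ∧ p + (u • (q - p) + v • (r - p)) = x := by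
  constructor
  · rw [convexHull_insert (by simp), convexHull_pair, mem_convexJoin]
    rintro ⟨a, ha, b, ⟨s, t, hs, ht, hst, rfl⟩, ⟨s', t', hs', ht', hst', rfl⟩⟩
    rw [mem_singleton_iff] at ha
    subst ha
    refine ⟨t' * s, t' * t, by positivity, by positivity, by nlinarith, ?_⟩
    obtain rfl : s' = 1 - t' := by linarith
    obtain rfl : s = 1 - t := by linarith
    ext <;> simp <;> ring
  · rintro ⟨u, v, hu, hv, huv, rfl⟩
    have hc := convex_convexHull ℝ ({p, q, r} : Set Pt)
    have hs := subset_convexHull ℝ ({p, q, r} : Set Pt)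
    have := hc.sum_mem (t := Finset.univ) (w := ![1 - u - v, u, v]) (z := ![p, q, r])
      (by intro i _; fin_cases i <;> simp <;> linarith)
      (by simp [Fin.sum_univ_three]; ring)
      (by intro i _; fin_cases i <;> exact hs (by simp))
    convert this using 1
    ext <;> simp [Fin.sum_univ_three] <;> ring

lemma volume_unit_triangle :
    volume {x : Pt | 0 ≤ x.1 ∧ 0 ≤ x.2 ∧ x.1 + x.2 ≤ 1} = ENNReal.ofReal (1 / 2) := by
  have hm : MeasurableSet {x : Pt | 0 ≤ x.1 ∧ 0 ≤ x.2 ∧ x.1 + x.2 ≤ 1} := by measurability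
  rw [Measure.volume_eq_prod, Measure.prod_apply hm]
  have hslice : ∀ x : ℝ, volume (Prod.mk x ⁻¹' {x : Pt | 0 ≤ x.1 ∧ 0 ≤ x.2 ∧ x.1 + x.2 ≤ 1}) =
      (Icc (0 : ℝ) 1).indicator (fun x => ENNReal.ofReal (1 - x)) x := by
    intro x
    by_cases hx : x ∈ Icc (0 : ℝ) 1
    · rw [indicator_of_mem hx]
      have : Prod.mk x ⁻¹' {x : Pt | 0 ≤ x.1 ∧ 0 ≤ x.2 ∧ x.1 + x.2 ≤ 1} = Icc 0 (1 - x) := by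
        ext y
        simp only [mem_preimage, mem_ofPred_eq, mem_Icc]
        constructor
        · rintro ⟨_, h, h'⟩; exact ⟨h, by linarith⟩
        · rintro ⟨h, h'⟩; exact ⟨hx.1, h, by linarith⟩
      rw [this, Real.volume_Icc, sub_zero]
    · rw [indicator_of_notMem hx]
      have : Prod.mk x ⁻¹' {x : Pt | 0 ≤ x.1 ∧ 0 ≤ x.2 ∧ x.1 + x.2 ≤ 1} = ∅ := by
        ext y
        simp only [mem_preimage, mem_ofPred_eq, mem_empty_iff_false, iff_false]
        rintro ⟨h0, h1, h2⟩
        exact hx ⟨h0, by linarith⟩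
      rw [this, measure_empty]
  simp_rw [hslice]
  rw [lintegral_indicator measurableSet_Icc, ← ofReal_integral_eq_lintegral_ofReal]
  · rw [integral_Icc_eq_integral_Ioc, ← intervalIntegral.integral_of_le zero_le_one]
    rw [intervalIntegral.integral_sub (by simp) (by simp), integral_id]
    norm_num
  · exact (by fun_prop : Continuous fun x : ℝ => 1 - x).integrableOn_Icc
  · filter_upwards [ae_restrict_mem measurableSet_Icc] with x hx
    simpa using hx.2

lemma volume_convexHull_triple (p q r : Pt) :
    volume (convexHull ℝ ({p, q, r} : Set Pt)) = ENNReal.ofReal (|triDet p q r| / 2) := by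
  let A : Matrix (Fin 2) (Fin 2) ℝ := !![q.1 - p.1, r.1 - p.1; q.2 - p.2, r.2 - p.2]
  let φ := Matrix.toLin (Module.Basis.finTwoProd ℝ) (Module.Basis.finTwoProd ℝ) A
  have hφ : ∀ x : Pt, φ x = x.1 • (q - p) + x.2 • (r - p) := by
    intro x
    simp only [φ, A, Matrix.toLin_finTwoProd_apply]
    ext <;> simp <;> ring
  have hdet : LinearMap.det φ = triDet p q r := by
    simp only [φ, A, LinearMap.det_toLin, Matrix.det_fin_two_of, triDet]
    ring
  have himg : convexHull ℝ ({p, q, r} : Set Pt) =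
      (fun x => p + x) '' (φ '' {x : Pt | 0 ≤ x.1 ∧ 0 ≤ x.2 ∧ x.1 + x.2 ≤ 1}) := by
    ext x
    rw [image_image]
    simp only [mem_convexHull_triple, mem_image, hφ, mem_ofPred_eq, Prod.exists, and_assoc]
  rw [himg, image_add_left, measure_preimage_add, Measure.addHaar_image_linearMap, hdet,
    volume_unit_triangle, ← ENNReal.ofReal_mul (abs_nonneg _)]
  congr 1
  ring

lemma toReal_volume_convexHull_triple (p q r : Pt) :
    (volume (convexHull ℝ ({p, q, r} : Set Pt))).toReal = |triDet p q r| / 2 := by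
  rw [volume_convexHull_triple, ENNReal.toReal_ofReal (by positivity)]

/-- A triangle with a vertical side contains the points in its half next to that side
lying at most half the length of the side above the lower edge. -/
lemma mem_convexHull_of_vertical_side {x y y' V W : ℝ} (hV : 0 < V) (hW : 0 < W) {p : Pt}
    (h0 : x ≤ p.1) (h1 : p.1 ≤ x + W)
    (h2 : 0 ≤ p.2 - y - (p.1 - x) * ((y' - y) / (2 * W)))
    (h3 : p.2 - y - (p.1 - x) * ((y' - y) / (2 * W)) ≤ V) :
    p ∈ convexHull ℝ ({(x, y), (x, y + 2 * V), (x + 2 * W, y')} : Set Pt) := by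
  rw [mem_convexHull_triple]
  have hu : (p.2 - y - (p.1 - x) * ((y' - y) / (2 * W))) / (2 * V) ≤ 1 / 2 := by
    rw [div_le_iff₀ (by positivity)]; linarith
  have hw : (p.1 - x) / (2 * W) ≤ 1 / 2 := by
    rw [div_le_iff₀ (by positivity)]; linarith
  refine ⟨_, _, div_nonneg h2 (by positivity : 0 ≤ 2 * V),
    div_nonneg (sub_nonneg.2 h0) (by positivity : 0 ≤ 2 * W), by linarith, ?_⟩
  ext
  · simp; field_simp; ring
  · simp; field_simp; ring

lemma diam_convexHull_triple_le {a b c : Pt} {D : ℝ} (hab : dist a b ≤ D) (hac : dist a c ≤ D)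
    (hbc : dist b c ≤ D) : Metric.diam (convexHull ℝ ({a, b, c} : Set Pt)) ≤ D := by
  rw [convexHull_diam]
  have hD : 0 ≤ D := dist_nonneg.trans hab
  refine Metric.diam_le_of_forall_dist_le hD ?_
  rintro x (rfl | rfl | rfl) y (rfl | rfl | rfl) <;>
    first | assumption | (rw [dist_self]; assumption) | (rw [dist_comm]; assumption)

lemma exists_int_div_le {M : ℕ} (hM : 0 < M) (x : ℝ) :
    ∃ i : ℤ, (i : ℝ) / M ≤ x ∧ x ≤ (i : ℝ) / M + 1 / M := by
  have hM' : (0 : ℝ) < M := by exact_mod_cast hM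
  refine ⟨⌊x * M⌋, ?_, ?_⟩
  · rw [div_le_iff₀ hM']; exact Int.floor_le _
  · rw [← add_div, le_div_iff₀ hM']; exact (Int.lt_floor_add_one _).le

/-- A lattice triangle around a thin parallelogram with two vertical sides. -/
lemma exists_lattice_triangle_of_parallelogram {M : ℕ} (hM : 100 < M) {x₀ c₀ s L H : ℝ}
    (hs : |s| ≤ 1) (hL0 : 0 ≤ L) (hL : L ≤ 1) (hH0 : 0 ≤ H) (hH : H ≤ 4) :
    ∃ a ∈ latticePts M, ∃ b ∈ latticePts M, ∃ c ∈ latticePts M,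
      (∀ p : Pt, x₀ ≤ p.1 → p.1 ≤ x₀ + L → c₀ ≤ p.2 - s * p.1 → p.2 - s * p.1 ≤ c₀ + H →
        p ∈ convexHull ℝ ({a, b, c} : Set Pt)) ∧
      |triDet a b c| / 2 ≤ 2 * L * H + 23 / M ∧
      Metric.diam (convexHull ℝ ({a, b, c} : Set Pt)) ≤ 12 := by
  have hM0 : 0 < M := by omega
  have hMR : (0 : ℝ) < M := by exact_mod_cast hM0
  obtain ⟨ε, hε⟩ : ∃ ε : ℝ, ε = 1 / M := ⟨_, rfl⟩
  have hε0 : 0 < ε := by rw [hε]; positivity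
  have hε1 : ε ≤ 1 / 100 := by
    rw [hε]; exact one_div_le_one_div_of_le (by norm_num) (by exact_mod_cast hM.le)
  obtain ⟨i, hi1, hi2⟩ := exists_int_div_le hM0 x₀
  obtain ⟨j, hj1, hj2⟩ := exists_int_div_le hM0 (c₀ + s * (i / M))
  obtain ⟨m, hm1, hm2⟩ := exists_int_div_le hM0 (L + 2 * ε)
  obtain ⟨n, hn1, hn2⟩ := exists_int_div_le hM0 (H + 3 * ε)
  obtain ⟨k, hk1, hk2⟩ := exists_int_div_le hM0 ((j : ℝ) / M + 2 * (m / M) * s)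
  rw [← hε] at hi2 hj2 hm2 hn2 hk2
  obtain ⟨x, hx⟩ : ∃ x : ℝ, x = i / M := ⟨_, rfl⟩
  obtain ⟨y, hy⟩ : ∃ y : ℝ, y = j / M := ⟨_, rfl⟩
  obtain ⟨W, hW⟩ : ∃ W : ℝ, W = m / M := ⟨_, rfl⟩
  obtain ⟨V, hV⟩ : ∃ V : ℝ, V = n / M := ⟨_, rfl⟩
  obtain ⟨y', hy'⟩ : ∃ y' : ℝ, y' = k / M := ⟨_, rfl⟩
  rw [← hx] at hi1 hi2 hj1 hj2
  rw [← hy] at hj1 hj2 hk1 hk2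
  rw [← hW] at hm1 hm2 hk1 hk2
  rw [← hV] at hn1 hn2
  rw [← hy'] at hk1 hk2
  have hW0 : 0 < W := by linarith
  have hV0 : 0 < V := by linarith
  have hs' := abs_le.1 hs
  have hWs : |W * s| ≤ W := by
    rw [abs_mul, abs_of_pos hW0]; nlinarith
  have hWs' := abs_le.1 hWs
  refine ⟨(x, y), ⟨i, j, by rw [hx, hy]⟩, (x, y + 2 * V), ⟨i, j + 2 * n, ?_⟩,
    (x + 2 * W, y'), ⟨i + 2 * m, k, ?_⟩, ?_, ?_, ?_⟩
  · rw [hx, hy, hV]; push_cast; ext <;> simp; ring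
  · rw [hx, hW, hy']; push_cast; ext <;> simp; ring
  · intro p h1 h2 h3 h4
    obtain ⟨σ, hσ⟩ : ∃ σ : ℝ, σ = (y' - y) / (2 * W) := ⟨_, rfl⟩
    have hσ1 : σ ≤ s := by
      rw [hσ, div_le_iff₀ (by positivity)]; linarith
    have hσ2 : W * (s - σ) ≤ ε / 2 := by
      have : W * σ = (y' - y) / 2 := by rw [hσ]; field_simp
      linarith
    have ht0 : 0 ≤ p.1 - x := by linarith
    have ht1 : p.1 - x ≤ W := by linarith
    have e1 : 0 ≤ (p.1 - x) * (s - σ) := mul_nonneg ht0 (by linarith)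
    have e2 : (p.1 - x) * (s - σ) ≤ W * (s - σ) :=
      mul_le_mul_of_nonneg_right ht1 (by linarith)
    have e3 : p.2 - y - (p.1 - x) * σ =
        p.2 - s * p.1 + s * x - y + (p.1 - x) * (s - σ) := by ring
    apply mem_convexHull_of_vertical_side hV0 hW0 <;> (try rw [← hσ, e3]) <;> linarith
  · have e : triDet (x, y) (x, y + 2 * V) (x + 2 * W, y') = -(4 * (V * W)) := by
      simp only [triDet]; ring
    rw [e, abs_neg, abs_of_pos (by positivity)]
    have : V * W ≤ (H + 3 * ε) * (L + 2 * ε) := by gcongr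
    have e2 : (23 : ℝ) / M = 23 * ε := by rw [hε]; ring
    rw [e2]
    have e3 : ε * H ≤ ε * 4 := by gcongr
    have e4 : ε * L ≤ ε * 1 := by gcongr
    have e5 : ε * ε ≤ ε * (1 / 100) := by gcongr
    have e6 : (H + 3 * ε) * (L + 2 * ε) =
        L * H + 2 * (ε * H) + 3 * (ε * L) + 6 * (ε * ε) := by ring
    linarith
  · apply diam_convexHull_triple_le <;> rw [Prod.dist_eq, Real.dist_eq, Real.dist_eq] <;>
      refine max_le (abs_le.2 ⟨?_, ?_⟩) (abs_le.2 ⟨?_, ?_⟩) <;> dsimp only <;> linarith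

/-- A lattice triangle around the unit square, for coarse lattices. -/
lemma exists_lattice_triangle_of_unit_square {M : ℕ} (hM0 : 0 < M) (x₀ y₀ : ℝ) :
    ∃ a ∈ latticePts M, ∃ b ∈ latticePts M, ∃ c ∈ latticePts M,
      (∀ p : Pt, x₀ ≤ p.1 → p.1 ≤ x₀ + 1 → y₀ ≤ p.2 → p.2 ≤ y₀ + 1 →
        p ∈ convexHull ℝ ({a, b, c} : Set Pt)) ∧
      |triDet a b c| / 2 ≤ 8 ∧
      Metric.diam (convexHull ℝ ({a, b, c} : Set Pt)) ≤ 12 := by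
  have hMR : (0 : ℝ) < M := by exact_mod_cast hM0
  obtain ⟨i, hi1, hi2⟩ := exists_int_div_le hM0 x₀
  obtain ⟨j, hj1, hj2⟩ := exists_int_div_le hM0 y₀
  have hε0 : 0 < 1 / (M : ℝ) := by positivity
  have hε1 : 1 / (M : ℝ) ≤ 1 := by
    rw [div_le_one hMR]; exact_mod_cast hM0
  obtain ⟨W, hW⟩ : ∃ W : ℝ, W = 2 := ⟨_, rfl⟩
  have hW0 : 0 < W := by rw [hW]; norm_num
  refine ⟨((i : ℝ) / M, (j : ℝ) / M), ⟨i, j, rfl⟩, ((i : ℝ) / M, (j : ℝ) / M + 2 * W),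
    ⟨i, j + 4 * M, ?_⟩, ((i : ℝ) / M + 2 * W, (j : ℝ) / M), ⟨i + 4 * M, j, ?_⟩, ?_, ?_, ?_⟩
  · rw [hW]; push_cast; ext <;> simp; field_simp; norm_num
  · rw [hW]; push_cast; ext <;> simp; field_simp; norm_num
  · intro p h1 h2 h3 h4
    apply mem_convexHull_of_vertical_side hW0 hW0 <;>
      (try simp only [sub_self, zero_div, mul_zero]) <;> linarith
  · simp only [triDet, hW]
    rw [show ∀ u v : ℝ, (u - u) * (v - v) - (v + 2 * 2 - v) * (u + 2 * 2 - u) = -16 by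
      intros; ring]
    norm_num
  · apply diam_convexHull_triple_le <;> rw [Prod.dist_eq, Real.dist_eq, Real.dist_eq] <;>
      refine max_le (abs_le.2 ⟨?_, ?_⟩) (abs_le.2 ⟨?_, ?_⟩) <;> dsimp only <;> linarith

/-- A compact convex set that is at least as wide as it is tall has a lattice triangle around
it whose area is controlled by the area of the set. -/
lemma exists_lattice_triangle_of_wide {M : ℕ} (hM : 100 < M) {K : Set Pt} (hK : IsCompact K)
    (hconv : Convex ℝ K) {p q : Pt} (hp : p ∈ K) (hq : q ∈ K)
    (hpK : ∀ x ∈ K, p.1 ≤ x.1) (hqK : ∀ x ∈ K, x.1 ≤ q.1) (hpq : q.1 - p.1 ≤ 1)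
    (hwide : ∀ x ∈ K, ∀ y ∈ K, y.2 - x.2 ≤ q.1 - p.1) :
    ∃ a ∈ latticePts M, ∃ b ∈ latticePts M, ∃ c ∈ latticePts M,
      K ⊆ convexHull ℝ ({a, b, c} : Set Pt) ∧
      |triDet a b c| / 2 ≤ 8 * (volume K).toReal + 23 / M ∧
      Metric.diam (convexHull ℝ ({a, b, c} : Set Pt)) ≤ 12 := by
  obtain ⟨L, hL⟩ : ∃ L : ℝ, L = q.1 - p.1 := ⟨_, rfl⟩
  obtain ⟨s, hs⟩ : ∃ s : ℝ, s = (q.2 - p.2) / L := ⟨_, rfl⟩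
  rw [← hL] at hpq hwide
  have hL0 : 0 ≤ L := by linarith [hpK q hq]
  have hqp := hwide p hp q hq
  have hpq' := hwide q hq p hp
  have hs1 : |s| ≤ 1 := by
    rw [hs, abs_div, abs_of_nonneg hL0]
    exact div_le_one_of_le₀ (abs_le.2 ⟨by linarith, by linarith⟩) hL0
  have hsL : s * L = q.2 - p.2 := by
    rcases hL0.eq_or_lt with h | h
    · rw [← h] at hqp hpq' ⊢; linarith
    · rw [hs]; field_simp
  obtain ⟨r, hr, hrmax⟩ := hK.exists_isMaxOn ⟨p, hp⟩
    (f := fun x : Pt => |x.2 - p.2 - s * (x.1 - p.1)|) (by fun_prop)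
  obtain ⟨e, he⟩ : ∃ e : ℝ, e = |r.2 - p.2 - s * (r.1 - p.1)| := ⟨_, rfl⟩
  have he0 : 0 ≤ e := by rw [he]; positivity
  have heK : ∀ x ∈ K, |x.2 - p.2 - s * (x.1 - p.1)| ≤ e := by
    intro x hx; rw [he]; exact hrmax hx
  have he2 : e ≤ 2 := by
    have h1 := hwide p hp r hr
    have h2 := hwide r hr p hp
    have h3 : |s * (r.1 - p.1)| ≤ 1 := by
      rw [abs_mul]
      exact mul_le_one₀ hs1 (abs_nonneg _)
        (abs_le.2 ⟨by linarith [hpK r hr], by linarith [hqK r hr]⟩)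
    have h4 := abs_le.1 h3
    rw [he]
    exact abs_le.2 ⟨by linarith, by linarith⟩
  have hdet : |triDet p q r| = L * e := by
    have : triDet p q r = L * (r.2 - p.2 - s * (r.1 - p.1)) := by
      simp only [triDet]; rw [← hL, ← hsL]; ring
    rw [this, abs_mul, abs_of_nonneg hL0, he]
  have harea : L * e / 2 ≤ (volume K).toReal := by
    rw [← hdet, ← toReal_volume_convexHull_triple]
    refine ENNReal.toReal_mono hK.measure_lt_top.ne (measure_mono ?_)
    refine convexHull_min ?_ hconv
    rintro x (rfl | rfl | rfl) <;> assumption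
  obtain ⟨a, ha, b, hb, c, hc, hin, hvol, hdiam⟩ :=
    exists_lattice_triangle_of_parallelogram hM (x₀ := p.1) (c₀ := p.2 - s * p.1 - e)
      (H := 2 * e) hs1 hL0 hpq (by linarith) (by linarith)
  refine ⟨a, ha, b, hb, c, hc, fun x hx => ?_, by linarith, hdiam⟩
  have h := abs_le.1 (heK x hx)
  exact hin x (hpK x hx) (by linarith [hqK x hx]) (by linarith) (by linarith)

lemma swap_mem_latticePts {M : ℕ} {p : Pt} (hp : p ∈ latticePts M) : p.swap ∈ latticePts M := by
  obtain ⟨a, b, rfl⟩ := hp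
  exact ⟨b, a, rfl⟩

lemma swap_mem_convexHull_triple {a b c x : Pt} (hx : x ∈ convexHull ℝ ({a, b, c} : Set Pt)) :
    x.swap ∈ convexHull ℝ ({a.swap, b.swap, c.swap} : Set Pt) := by
  rw [mem_convexHull_triple] at hx ⊢
  obtain ⟨u, v, hu, hv, huv, rfl⟩ := hx
  exact ⟨u, v, hu, hv, huv, rfl⟩

lemma abs_triDet_swap (a b c : Pt) : |triDet a.swap b.swap c.swap| = |triDet a b c| := by
  rw [← abs_neg]
  congr 1
  simp only [triDet, Prod.fst_swap, Prod.snd_swap]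
  ring

lemma diam_convexHull_swap (a b c : Pt) :
    Metric.diam (convexHull ℝ ({a.swap, b.swap, c.swap} : Set Pt)) =
      Metric.diam (convexHull ℝ ({a, b, c} : Set Pt)) := by
  have hiso : Isometry (Prod.swap : Pt → Pt) :=
    Isometry.of_dist_eq fun x y => by simp [Prod.dist_eq, max_comm]
  rw [convexHull_diam, convexHull_diam, ← hiso.diam_image, image_insert_eq, image_pair]
  simp only [Prod.swap_swap]

/-- A compact convex set in a unit square has a lattice triangle around it whose area is
controlled by the area of the set. -/
lemma exists_lattice_triangle {M : ℕ} (hM : 100 < M) {K : Set Pt} (hK : IsCompact K)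
    (hne : K.Nonempty) (hconv : Convex ℝ K) (h1 : ∀ x ∈ K, ∀ y ∈ K, dist x y ≤ 1) :
    ∃ a ∈ latticePts M, ∃ b ∈ latticePts M, ∃ c ∈ latticePts M,
      K ⊆ convexHull ℝ ({a, b, c} : Set Pt) ∧
      |triDet a b c| / 2 ≤ 8 * (volume K).toReal + 23 / M ∧
      Metric.diam (convexHull ℝ ({a, b, c} : Set Pt)) ≤ 12 := by
  obtain ⟨p, hp, hpK⟩ := hK.exists_isMinOn hne continuous_fst.continuousOn
  obtain ⟨q, hq, hqK⟩ := hK.exists_isMaxOn hne continuous_fst.continuousOn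
  obtain ⟨p', hp', hpK'⟩ := hK.exists_isMinOn hne continuous_snd.continuousOn
  obtain ⟨q', hq', hqK'⟩ := hK.exists_isMaxOn hne continuous_snd.continuousOn
  have hd1 : q.1 - p.1 ≤ 1 := by
    have := h1 q hq p hp
    rw [Prod.dist_eq] at this
    exact (le_abs_self _).trans ((le_max_left _ _).trans this)
  have hd2 : q'.2 - p'.2 ≤ 1 := by
    have := h1 q' hq' p' hp'
    rw [Prod.dist_eq] at this
    exact (le_abs_self _).trans ((le_max_right _ _).trans this)
  have hpK : ∀ x ∈ K, p.1 ≤ x.1 := fun x hx => hpK hx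
  have hqK : ∀ x ∈ K, x.1 ≤ q.1 := fun x hx => hqK hx
  have hpK' : ∀ x ∈ K, p'.2 ≤ x.2 := fun x hx => hpK' hx
  have hqK' : ∀ x ∈ K, x.2 ≤ q'.2 := fun x hx => hqK' hx
  rcases le_total (q'.2 - p'.2) (q.1 - p.1) with h | h
  · exact exists_lattice_triangle_of_wide hM hK hconv hp hq hpK hqK hd1
      fun x hx y hy => by linarith [hpK' x hx, hqK' y hy]
  · have hvol : volume (Prod.swap ⁻¹' K) = volume K :=
      (Measure.measurePreserving_swap (μ := (volume : Measure ℝ))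
        (ν := (volume : Measure ℝ))).measure_preimage hK.measurableSet.nullMeasurableSet
    have hKs : IsCompact (Prod.swap ⁻¹' K) := by
      rw [← image_swap_eq_preimage_swap]; exact hK.image continuous_swap
    have hconvs : Convex ℝ (Prod.swap ⁻¹' K : Set Pt) :=
      hconv.linear_preimage (LinearEquiv.prodComm ℝ ℝ ℝ).toLinearMap
    obtain ⟨a, ha, b, hb, c, hc, hin, hv, hdiam⟩ := exists_lattice_triangle_of_wide hM hKs hconvs
      (p := p'.swap) (q := q'.swap) hp' hq' (fun x hx => hpK' _ hx) (fun x hx => hqK' _ hx) hd2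
      fun x hx y hy => h.trans' (by
        have h1 := hpK _ hx
        have h2 := hqK _ hy
        simp only [Prod.fst_swap] at h1 h2
        linarith)
    refine ⟨_, swap_mem_latticePts ha, _, swap_mem_latticePts hb, _, swap_mem_latticePts hc,
      fun x hx => ?_, ?_, ?_⟩
    · exact swap_mem_convexHull_triple (hin (show x.swap ∈ Prod.swap ⁻¹' K by simpa using hx))
    · rwa [abs_triDet_swap, ← hvol]
    · rwa [diam_convexHull_swap]

/-- bounding lattice triangle: every closed convex subset `K` of a compact
convex set of diameter `1` is contained in a lattice triangle of diameter at most `12` whose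
area is at most `64 S` (if `S > 100/M`) or at most `6400/M` (if `S ≤ 100/M`), where `S` is the
area of `K`. -/
theorem bounding_lattice_triangle (Γ : Set Pt) (hΓc : IsCompact Γ) (hΓconv : Convex ℝ Γ)
    (hΓdiam : Metric.diam Γ = 1) (M : ℕ) (hM : 0 < M)
    (K : Set Pt) (hKΓ : K ⊆ Γ) (hKcl : IsClosed K) (hKconv : Convex ℝ K)
    (S : ℝ) (hS : S = (volume K).toReal) :
    (100 / (M : ℝ) < S →
      ∃ a b c : Pt, a ∈ latticePts M ∧ b ∈ latticePts M ∧ c ∈ latticePts M ∧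
        K ⊆ convexHull ℝ ({a, b, c} : Set Pt) ∧
        (volume (convexHull ℝ ({a, b, c} : Set Pt))).toReal ≤ 64 * S ∧
        Metric.diam (convexHull ℝ ({a, b, c} : Set Pt)) ≤ 12) ∧
    (S ≤ 100 / (M : ℝ) →
      ∃ a b c : Pt, a ∈ latticePts M ∧ b ∈ latticePts M ∧ c ∈ latticePts M ∧
        K ⊆ convexHull ℝ ({a, b, c} : Set Pt) ∧
        (volume (convexHull ℝ ({a, b, c} : Set Pt))).toReal ≤ 6400 / M ∧
        Metric.diam (convexHull ℝ ({a, b, c} : Set Pt)) ≤ 12) := by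
  have hMR : (0 : ℝ) < M := by exact_mod_cast hM
  have hS0 : 0 ≤ S := by rw [hS]; exact ENNReal.toReal_nonneg
  have hKc : IsCompact K := hΓc.of_isClosed_subset hKcl hKΓ
  have hdist : ∀ x ∈ K, ∀ y ∈ K, dist x y ≤ 1 := fun x hx y hy =>
    hΓdiam ▸ Metric.dist_le_diam_of_mem hΓc.isBounded (hKΓ hx) (hKΓ hy)
  suffices h : ∃ a ∈ latticePts M, ∃ b ∈ latticePts M, ∃ c ∈ latticePts M,
      K ⊆ convexHull ℝ ({a, b, c} : Set Pt) ∧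
      (100 / (M : ℝ) < S → |triDet a b c| / 2 ≤ 64 * S) ∧
      (S ≤ 100 / (M : ℝ) → |triDet a b c| / 2 ≤ 6400 / M) ∧
      Metric.diam (convexHull ℝ ({a, b, c} : Set Pt)) ≤ 12 by
    obtain ⟨a, ha, b, hb, c, hc, hin, hlarge, hsmall, hdiam⟩ := h
    rw [← toReal_volume_convexHull_triple] at hlarge hsmall
    exact ⟨fun h => ⟨a, b, c, ha, hb, hc, hin, hlarge h, hdiam⟩,
      fun h => ⟨a, b, c, ha, hb, hc, hin, hsmall h, hdiam⟩⟩
  rcases K.eq_empty_or_nonempty with rfl | hne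
  · have h0 : (0 : Pt) ∈ latticePts M := ⟨0, 0, by simp; rfl⟩
    refine ⟨0, h0, 0, h0, 0, h0, empty_subset _, fun _ => ?_, fun _ => ?_, ?_⟩
    · simp [triDet, hS0]
    · simp only [triDet, sub_self, mul_zero, abs_zero, zero_div]
      positivity
    · simp
  rcases lt_or_ge 100 M with hM100 | hM100
  · obtain ⟨a, ha, b, hb, c, hc, hin, hv, hdiam⟩ :=
      exists_lattice_triangle hM100 hKc hne hKconv hdist
    rw [← hS] at hv
    have e1 : 23 / (M : ℝ) = 23 * (1 / M) := by ring
    have e2 : 100 / (M : ℝ) = 100 * (1 / M) := by ring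
    have e3 : 6400 / (M : ℝ) = 6400 * (1 / M) := by ring
    have hε0 : 0 < 1 / (M : ℝ) := by positivity
    rw [e1] at hv
    rw [e2, e3]
    exact ⟨a, ha, b, hb, c, hc, hin, fun h => by linarith, fun h => by linarith, hdiam⟩
  · have hM100' : (M : ℝ) ≤ 100 := by exact_mod_cast hM100
    have h1M : 1 ≤ 100 / (M : ℝ) := by rwa [le_div_iff₀ hMR, one_mul]
    obtain ⟨p, hp, hpK⟩ := hKc.exists_isMinOn hne continuous_fst.continuousOn
    obtain ⟨q, hq, hqK⟩ := hKc.exists_isMinOn hne continuous_snd.continuousOn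
    obtain ⟨a, ha, b, hb, c, hc, hin, hv, hdiam⟩ :=
      exists_lattice_triangle_of_unit_square hM p.1 q.2
    refine ⟨a, ha, b, hb, c, hc, fun x hx => ?_, fun h => by linarith, fun _ => ?_, hdiam⟩
    · have h1 := (max_le_iff.1 (Prod.dist_eq (x := x) (y := p) ▸ hdist x hx p hp)).1
      have h2 := (max_le_iff.1 (Prod.dist_eq (x := x) (y := q) ▸ hdist x hx q hq)).2
      rw [Real.dist_eq] at h1 h2
      exact hin x (hpK hx) (by linarith [le_abs_self (x.1 - p.1)]) (hqK hx)
        (by linarith [le_abs_self (x.2 - q.2)])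
    · refine hv.trans ?_
      rw [le_div_iff₀ hMR]
      linarith
end
end
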